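/- Let (q_n) be a sequence of reals in (0,1) satisfying q_n → 1 and n(1−q_n) → ∞ as n → ∞, and for each n let π_n be distributed according to the (n,q_n)-Mallows measure. Then LIS(π_n)/(n·√(1−q_n)) → 1 as n → ∞, where the convergence holds in L_p for every 0 < p < ∞; that is, for every 0<p<∞, E | LIS(π_n)/(n·√(1−q_n)) − 1 |^p → 0 as n → ∞. -/

import Mathlib

open Finset

/-- Number of inversions of a permutation of `Fin n`. -/
def mallowsInv {n : ℕ} (π : Equiv.Perm (Fin n)) : ℕ :=
  (Finset.univ.filter (fun p : Fin n × Fin n => p.1 < p.2 ∧ π p.2 < π p.1)).card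

/-- The `(n,q)`-Mallows probability mass function on `S_n`. -/
noncomputable def mallowsPMF (n : ℕ) (q : ℝ) (π : Equiv.Perm (Fin n)) : ℝ :=
  q ^ mallowsInv π / ∑ σ : Equiv.Perm (Fin n), q ^ mallowsInv σ

/-- Probability of an event under the `(n,q)`-Mallows measure. -/
noncomputable def mallowsProb (n : ℕ) (q : ℝ) (A : Set (Equiv.Perm (Fin n))) : ℝ :=
  ∑ π : Equiv.Perm (Fin n), A.indicator (mallowsPMF n q) π

/-- Expectation of a function under the `(n,q)`-Mallows measure. -/
noncomputable def mallowsExp (n : ℕ) (q : ℝ) (f : Equiv.Perm (Fin n) → ℝ) : ℝ :=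
  ∑ π : Equiv.Perm (Fin n), mallowsPMF n q π * f π

/-- Length of the longest increasing subsequence of a permutation of `Fin n`. -/
noncomputable def LIS {n : ℕ} (π : Equiv.Perm (Fin n)) : ℕ :=
  sSup {m | ∃ f : Fin m → Fin n, StrictMono f ∧ StrictMono (fun j => π (f j))}

/-- Length of the longest decreasing subsequence of a permutation of `Fin n`. -/
noncomputable def LDS {n : ℕ} (π : Equiv.Perm (Fin n)) : ℕ :=
  sSup {m | ∃ f : Fin m → Fin n, StrictMono f ∧ StrictAnti (fun j => π (f j))}

namespace MallowsLIS

/-- Functionals on the states `ℕ → ℕ` that are monotone and commute with adding `1`. -/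
structure Equivariant (F : (ℕ → ℕ) → ℝ) : Prop where
  mono : Monotone F
  add_one : ∀ h, F (h + 1) = F h + 1

theorem Equivariant.add_const {F : (ℕ → ℕ) → ℝ} (hF : Equivariant F) (h : ℕ → ℕ) (k : ℕ) :
    F (h + fun _ => k) = F h + k := by
  induction k with
  | zero => simp [show (h + fun _ => 0) = h from by ext; simp]
  | succ k ih =>
    have : (h + fun _ => k + 1) = (h + fun _ => k) + 1 := by ext; simp [add_assoc]
    rw [this, hF.add_one, ih]; push_cast; ring

theorem Equivariant.sum {ι : Type*} (s : Finset ι) (w : ι → ℝ) (F : ι → (ℕ → ℕ) → ℝ)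
    (hw : ∀ i ∈ s, 0 ≤ w i) (hw1 : ∑ i ∈ s, w i = 1) (hF : ∀ i ∈ s, Equivariant (F i)) :
    Equivariant (fun h => ∑ i ∈ s, w i * F i h) where
  mono := fun a b hab => sum_le_sum fun i hi =>
    mul_le_mul_of_nonneg_left ((hF i hi).mono hab) (hw i hi)
  add_one := fun h => by
    rw [← hw1, ← sum_add_distrib]
    exact sum_congr rfl fun i hi => by rw [(hF i hi).add_one]; ring

/-- Effect on the depth profile of appending a value with `g` larger values. -/
def depthStep (g : ℕ) (h : ℕ → ℕ) (j : ℕ) : ℕ :=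
  if j ≤ g then max (h j) (h g + 1) else h (j - 1)

/-- Profiles: nonincreasing with downward jumps of size at most one. -/
def IsProfile (h : ℕ → ℕ) : Prop := Antitone h ∧ ∀ j, h j ≤ h (j + 1) + 1

theorem isProfile_zero : IsProfile 0 := ⟨antitone_const, fun j => by simp⟩

theorem le_depthStep {h : ℕ → ℕ} (hh : IsProfile h) (g : ℕ) : h ≤ depthStep g h := by
  intro j
  unfold depthStep
  split_ifs with hj
  · exact le_max_left _ _
  · exact hh.1 (by omega)

theorem depthStep_le {h : ℕ → ℕ} (hh : IsProfile h) (g : ℕ) : depthStep g h ≤ h + 1 := by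
  intro j
  unfold depthStep
  simp only [Pi.add_apply, Pi.one_apply]
  split_ifs with hj
  · have := hh.1 hj
    omega
  · have := hh.2 (j - 1)
    rwa [show j - 1 + 1 = j by omega] at this

theorem IsProfile.depthStep {h : ℕ → ℕ} (hh : IsProfile h) (g : ℕ) :
    IsProfile (depthStep g h) := by
  have key : ∀ j, MallowsLIS.depthStep g h (j + 1) ≤ MallowsLIS.depthStep g h j ∧
      MallowsLIS.depthStep g h j ≤ MallowsLIS.depthStep g h (j + 1) + 1 := by
    intro j
    unfold MallowsLIS.depthStep
    rcases lt_trichotomy j g with hj | rfl | hj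
    · rw [if_pos (by omega), if_pos hj.le]
      have h1 := hh.1 (Nat.le_succ j)
      have h2 := hh.2 j
      simp only [Nat.succ_eq_add_one] at h1
      omega
    · simp
    · rw [if_neg (by omega), if_neg (by omega)]
      have h1 := hh.1 (Nat.le_succ (j - 1))
      have h2 := hh.2 (j - 1)
      simp only [Nat.succ_eq_add_one, show j - 1 + 1 = j by omega, Nat.add_sub_cancel] at *
      omega
  exact ⟨antitone_nat_of_succ_le fun j => (key j).1, fun j => (key j).2⟩

theorem depthStep_mono (g : ℕ) : Monotone (depthStep g) := by
  intro a b hab j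
  unfold depthStep
  split_ifs
  · exact max_le_max (hab j) (Nat.add_le_add_right (hab g) 1)
  · exact hab _

theorem depthStep_add_one (g : ℕ) (h : ℕ → ℕ) : depthStep g (h + 1) = depthStep g h + 1 := by
  ext j
  simp only [depthStep, Pi.add_apply, Pi.one_apply]
  split_ifs
  · omega
  · rfl

/-- Probability that the value appended at time `t` has `g` larger values. -/
noncomputable def depthWeight (q : ℝ) (t g : ℕ) : ℝ := (1 - q) * q ^ g / (1 - q ^ (t + 1))

section weights
variable {q : ℝ} (hq0 : 0 < q) (hq1 : q < 1)
include hq0 hq1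

theorem one_sub_pow_pos (t : ℕ) : 0 < 1 - q ^ (t + 1) :=
  sub_pos.2 (pow_lt_one₀ hq0.le hq1 (by omega))

theorem depthWeight_nonneg (t g : ℕ) : 0 ≤ depthWeight q t g :=
  div_nonneg (mul_nonneg (by linarith) (by positivity)) (one_sub_pow_pos hq0 hq1 t).le

omit hq0 hq1 in
theorem sum_depthWeight_range (t k : ℕ) :
    ∑ g ∈ range k, depthWeight q t g = (1 - q ^ k) / (1 - q ^ (t + 1)) := by
  simp only [depthWeight]
  rw [← sum_div, ← mul_sum, mul_comm, geom_sum_mul_neg]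

theorem sum_depthWeight (t : ℕ) : ∑ g ∈ range (t + 1), depthWeight q t g = 1 := by
  rw [sum_depthWeight_range, div_self (one_sub_pow_pos hq0 hq1 t).ne']
end weights

/-- One-step transition operator of the profile chain. -/
noncomputable def trans (q : ℝ) (t : ℕ) : ((ℕ → ℕ) → ℝ) →ₗ[ℝ] ((ℕ → ℕ) → ℝ) :=
  ∑ g ∈ range (t + 1), depthWeight q t g • LinearMap.funLeft ℝ ℝ (depthStep g)

theorem trans_apply (q : ℝ) (t : ℕ) (F : (ℕ → ℕ) → ℝ) (h : ℕ → ℕ) :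
    trans q t F h = ∑ g ∈ range (t + 1), depthWeight q t g * F (depthStep g h) := by
  simp [trans, LinearMap.sum_apply, Finset.sum_apply, LinearMap.funLeft]

/-- Expectation at time `n` for the profile chain started from `0`. -/
noncomputable def chainExp (q : ℝ) : ℕ → (((ℕ → ℕ) → ℝ) →ₗ[ℝ] ℝ)
  | 0 => LinearMap.proj 0
  | n + 1 => (chainExp q n).comp (trans q n)

theorem chainExp_zero (q : ℝ) (F : (ℕ → ℕ) → ℝ) : chainExp q 0 F = F 0 := rfl

theorem chainExp_succ (q : ℝ) (n : ℕ) (F : (ℕ → ℕ) → ℝ) :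
    chainExp q (n + 1) F = chainExp q n (trans q n F) := rfl

section operators
variable {q : ℝ} (hq0 : 0 < q) (hq1 : q < 1)
include hq0 hq1

theorem trans_le_trans {F G : (ℕ → ℕ) → ℝ} (hFG : ∀ h, IsProfile h → F h ≤ G h) (t : ℕ)
    (h : ℕ → ℕ) (hh : IsProfile h) : trans q t F h ≤ trans q t G h := by
  simp only [trans_apply]
  exact sum_le_sum fun g _ => mul_le_mul_of_nonneg_left (hFG _ (hh.depthStep g))
    (depthWeight_nonneg hq0 hq1 _ _)

theorem trans_const (t : ℕ) (c : ℝ) : trans q t (fun _ => c) = fun _ => c := by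
  ext h
  rw [trans_apply, ← sum_mul, sum_depthWeight hq0 hq1, one_mul]

theorem chainExp_mono (n : ℕ) {F G : (ℕ → ℕ) → ℝ} (hFG : ∀ h, IsProfile h → F h ≤ G h) :
    chainExp q n F ≤ chainExp q n G := by
  induction n generalizing F G with
  | zero => exact hFG _ isProfile_zero
  | succ n ih => exact ih fun h hh => trans_le_trans hq0 hq1 hFG n h hh

theorem chainExp_const (n : ℕ) (c : ℝ) : chainExp q n (fun _ => c) = c := by
  induction n with
  | zero => rfl
  | succ n ih => rw [chainExp_succ, trans_const hq0 hq1, ih]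

theorem chainExp_add_const (n : ℕ) (F : (ℕ → ℕ) → ℝ) (c : ℝ) :
    chainExp q n (fun h => F h + c) = chainExp q n F + c := by
  have : (fun h => F h + c) = F + fun _ => c := rfl
  rw [this, map_add, chainExp_const hq0 hq1]

theorem Equivariant.trans {F : (ℕ → ℕ) → ℝ} (hF : Equivariant F) (t : ℕ) :
    Equivariant (trans q t F) := by
  have : MallowsLIS.trans q t F =
      fun h => ∑ g ∈ range (t + 1), depthWeight q t g * F (depthStep g h) := by
    ext h; exact trans_apply ..
  rw [this]
  exact Equivariant.sum _ _ (fun g h => F (depthStep g h))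
    (fun g _ => depthWeight_nonneg hq0 hq1 t g) (sum_depthWeight hq0 hq1 t)
    fun g _ => ⟨fun a b hab => hF.mono (depthStep_mono g hab),
      fun h => by rw [depthStep_add_one, hF.add_one]⟩
end operators

open Classical in
/-- Longest increasing subsequence among the values having at least `j` larger values. -/
noncomputable def profile {n : ℕ} (π : Equiv.Perm (Fin n)) (j : ℕ) : ℕ :=
  (univ.filter fun s : Finset (Fin n) =>
    StrictMonoOn π s ∧ ∀ x ∈ s, (π x : ℕ) + j < n).sup card

theorem le_profile {n : ℕ} {π : Equiv.Perm (Fin n)} {j : ℕ} {s : Finset (Fin n)}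
    (h1 : StrictMonoOn π s) (h2 : ∀ x ∈ s, (π x : ℕ) + j < n) : s.card ≤ profile π j := by
  classical
  unfold profile
  exact le_sup (f := card) (by simpa using ⟨h1, h2⟩)

theorem exists_profile {n : ℕ} (π : Equiv.Perm (Fin n)) (j : ℕ) :
    ∃ s : Finset (Fin n), StrictMonoOn π s ∧ (∀ x ∈ s, (π x : ℕ) + j < n) ∧
      s.card = profile π j := by
  classical
  obtain ⟨s, hs, hs'⟩ := exists_mem_eq_sup
    (univ.filter fun s : Finset (Fin n) => StrictMonoOn π s ∧ ∀ x ∈ s, (π x : ℕ) + j < n)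
    ⟨∅, by simp [StrictMonoOn]⟩ card
  simp only [mem_filter, mem_univ, true_and] at hs
  exact ⟨s, hs.1, hs.2, by rw [← hs']; unfold profile; congr⟩

theorem LIS_eq_profile {n : ℕ} (π : Equiv.Perm (Fin n)) : LIS π = profile π 0 := by
  have hb : ∀ m ∈ {m | ∃ f : Fin m → Fin n, StrictMono f ∧ StrictMono (fun j => π (f j))},
      m ≤ profile π 0 := by
    rintro m ⟨f, hf, hf'⟩
    have := le_profile (π := π) (j := 0) (s := univ.map ⟨f, hf.injective⟩) (by
      intro x hx y hy hxy
      simp only [coe_map, Function.Embedding.coeFn_mk, coe_univ, Set.image_univ,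
        Set.mem_range] at hx hy
      obtain ⟨i, rfl⟩ := hx
      obtain ⟨k, rfl⟩ := hy
      exact hf' (hf.lt_iff_lt.1 hxy)) (fun x _ => by simp)
    simpa using this
  apply le_antisymm
  · exact csSup_le ⟨0, Fin.elim0, fun i => i.elim0, fun i => i.elim0⟩ hb
  · apply le_csSup ⟨_, hb⟩
    obtain ⟨s, h1, h2, h3⟩ := exists_profile π 0
    refine ⟨fun i => s.orderEmbOfFin h3 i, (s.orderEmbOfFin h3).strictMono, fun i k hik => ?_⟩
    exact h1 (by simp) (by simp) ((s.orderEmbOfFin h3).strictMono hik)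

/-- The permutation obtained from `π` by appending the value `v` (and shifting larger values). -/
def appendValue {n : ℕ} (v : Fin (n + 1)) (π : Equiv.Perm (Fin n)) : Equiv.Perm (Fin (n + 1)) :=
  finSuccEquivLast.trans ((Equiv.optionCongr π).trans (finSuccEquiv' v).symm)

@[simp] theorem appendValue_last {n : ℕ} (v : Fin (n + 1)) (π : Equiv.Perm (Fin n)) :
    appendValue v π (Fin.last n) = v := by simp [appendValue]

@[simp] theorem appendValue_castSucc {n : ℕ} (v : Fin (n + 1)) (π : Equiv.Perm (Fin n))
    (i : Fin n) : appendValue v π i.castSucc = v.succAbove (π i) := by simp [appendValue]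

theorem appendValue_bijective (n : ℕ) :
    Function.Bijective (fun x : Fin (n + 1) × Equiv.Perm (Fin n) => appendValue x.1 x.2) := by
  rw [Fintype.bijective_iff_injective_and_card]
  constructor
  · rintro ⟨v, π⟩ ⟨v', π'⟩ h
    simp only at h
    have h1 : v = v' := by
      have := congrArg (fun σ => σ (Fin.last n)) h
      simpa using this
    subst h1
    have h2 : π = π' := by
      ext i
      have := congrArg (fun σ => σ i.castSucc) h
      simp only [appendValue_castSucc, Fin.succAbove_right_inj] at this
      rw [this]
    rw [h2]
  · simp [Fintype.card_perm, Nat.factorial_succ]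

theorem val_succAbove {n : ℕ} (v : Fin (n + 1)) (i : Fin n) :
    ((v.succAbove i : Fin (n + 1)) : ℕ) = if (i : ℕ) < v then (i : ℕ) else i + 1 := by
  simp only [Fin.succAbove, Fin.lt_def, Fin.val_castSucc]
  split_ifs <;> simp

theorem mallowsInv_appendValue {n : ℕ} (v : Fin (n + 1)) (π : Equiv.Perm (Fin n)) :
    mallowsInv (appendValue v π) = mallowsInv π + (n - v) := by
  have e : ∀ (m : ℕ) (σ : Equiv.Perm (Fin m)), mallowsInv σ =
      ∑ i, ∑ j, if i < j ∧ σ j < σ i then 1 else 0 := by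
    intro m σ
    rw [mallowsInv, card_filter, ← univ_product_univ, sum_product]
  rw [e, e, Fin.sum_univ_castSucc]
  have h2 : (∑ j, if Fin.last n < j ∧ (appendValue v π) j < (appendValue v π) (Fin.last n)
      then 1 else 0) = 0 := by
    apply sum_eq_zero
    intro j _
    rw [if_neg]
    rintro ⟨h, -⟩
    exact absurd h (not_lt.2 (Fin.le_last j))
  rw [h2, add_zero]
  simp only [Fin.sum_univ_castSucc (n := n), appendValue_castSucc, appendValue_last,
    Fin.castSucc_lt_castSucc_iff, Fin.succAbove_lt_succAbove_iff, Fin.castSucc_lt_last, true_and]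
  rw [sum_add_distrib]
  congr 1
  rw [Equiv.sum_comp π (fun k => if v < v.succAbove k then 1 else 0), ← card_filter]
  have : ∀ k : Fin n, v < v.succAbove k ↔ (v : ℕ) ≤ k := by
    intro k
    rw [Fin.lt_def, val_succAbove]
    split_ifs <;> omega
  simp only [this]
  have hc : (univ.filter fun k : Fin n => (k : ℕ) < v).card = min n v := Fin.card_filter_val_lt
  have := card_filter_add_card_filter_not (s := (univ : Finset (Fin n)))
    (fun k : Fin n => (k : ℕ) < v)
  simp only [not_lt, card_univ, Fintype.card_fin] at this
  have hv := v.is_lt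
  omega

theorem profile_appendValue {n : ℕ} (v : Fin (n + 1)) (π : Equiv.Perm (Fin n)) :
    profile (appendValue v π) = depthStep (n - v) (profile π) := by
  classical
  have hv := v.is_lt
  -- old elements
  have old : ∀ (j : ℕ) (i : Fin n), ((v.succAbove (π i) : Fin (n + 1)) : ℕ) + j < n + 1 ↔
      (π i : ℕ) + (if j ≤ n - v then j else j - 1) < n := by
    intro j i
    rw [val_succAbove]
    have := (π i).is_lt
    split_ifs <;> omega
  have hmono : ∀ s : Finset (Fin n), StrictMonoOn π s →
      StrictMonoOn (appendValue v π) (s.map Fin.castSuccEmb : Finset (Fin (n + 1))) := by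
    intro s hs x hx y hy hxy
    simp only [coe_map, Set.mem_image, mem_coe, Fin.coe_castSuccEmb] at hx hy
    obtain ⟨x, hx, rfl⟩ := hx
    obtain ⟨y, hy, rfl⟩ := hy
    rw [appendValue_castSucc, appendValue_castSucc, Fin.succAbove_lt_succAbove_iff]
    exact hs hx hy (by simpa using hxy)
  ext j
  apply le_antisymm
  · obtain ⟨s', h1, h2, h3⟩ := exists_profile (appendValue v π) j
    rw [← h3]
    set s : Finset (Fin n) := univ.filter fun i => i.castSucc ∈ s' with hs
    have hsm : StrictMonoOn π s := by
      intro x hx y hy hxy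
      simp only [hs, coe_filter, mem_univ, true_and, Set.mem_ofPred_eq] at hx hy
      have := h1 hx hy (by simpa using hxy)
      simpa using this
    have hsj : ∀ x ∈ s, (π x : ℕ) + (if j ≤ n - v then j else j - 1) < n := by
      intro x hx
      simp only [hs, mem_filter, mem_univ, true_and] at hx
      have := h2 _ hx
      rw [appendValue_castSucc, old] at this
      exact this
    by_cases hl : Fin.last n ∈ s'
    · have hjv : j ≤ n - v := by
        have := h2 _ hl
        rw [appendValue_last] at this
        omega
      have hs' : s' = insert (Fin.last n) (s.map Fin.castSuccEmb) := by
        ext x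
        refine Fin.lastCases ?_ (fun i => ?_) x
        · simp [hl]
        · simp [hs, (Fin.castSucc_lt_last i).ne]
      have hc : s'.card ≤ s.card + 1 := by
        rw [hs']
        exact (card_insert_le _ _).trans (by rw [card_map])
      have hp : s.card ≤ profile π (n - v) := by
        apply le_profile hsm
        intro x hx
        simp only [hs, mem_filter, mem_univ, true_and] at hx
        have := h1 hx hl (Fin.castSucc_lt_last x)
        rw [appendValue_last, appendValue_castSucc, Fin.lt_def, val_succAbove] at this
        split_ifs at this <;> omega
      unfold depthStep
      rw [if_pos hjv]
      exact le_max_of_le_right (by omega)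
    · have hs' : s' = s.map Fin.castSuccEmb := by
        ext x
        refine Fin.lastCases ?_ (fun i => ?_) x
        · simp [hl, (Fin.castSucc_lt_last _).ne]
        · simp [hs]
      have hc : s'.card = s.card := by rw [hs', card_map]
      rw [hc]
      have := le_profile hsm hsj
      unfold depthStep
      split_ifs at this ⊢
      · exact le_max_of_le_left this
      · exact this
  · have hold : profile π (if j ≤ n - v then j else j - 1) ≤ profile (appendValue v π) j := by
      obtain ⟨s, h1, h2, h3⟩ := exists_profile π (if j ≤ n - v then j else j - 1)
      rw [← h3, ← card_map Fin.castSuccEmb]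
      apply le_profile (hmono s h1)
      intro x hx
      simp only [mem_map, Fin.coe_castSuccEmb] at hx
      obtain ⟨x, hx, rfl⟩ := hx
      rw [appendValue_castSucc, old]
      exact h2 x hx
    unfold depthStep
    split_ifs at hold ⊢ with hj
    · apply max_le hold
      obtain ⟨s, h1, h2, h3⟩ := exists_profile π (n - v)
      have hlt : ∀ x ∈ s, v.succAbove (π x) < v := by
        intro x hx
        have := h2 x hx
        rw [Fin.lt_def, val_succAbove]
        split_ifs <;> omega
      rw [← h3]
      have hc : (insert (Fin.last n) (s.map Fin.castSuccEmb)).card = s.card + 1 := by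
        rw [card_insert_of_notMem, card_map]
        simp [(Fin.castSucc_lt_last _).ne]
      rw [← hc]
      apply le_profile
      · intro x hx y hy hxy
        simp only [coe_insert, coe_map, Set.mem_insert_iff, Set.mem_image, mem_coe,
          Fin.coe_castSuccEmb] at hx hy
        rcases hx with rfl | ⟨x, hx, rfl⟩
        · exact absurd hxy (not_lt.2 (Fin.le_last y))
        · rcases hy with rfl | ⟨y, hy, rfl⟩
          · rw [appendValue_castSucc, appendValue_last]
            exact hlt x hx
          · exact hmono s h1 (by simpa using hx) (by simpa using hy) hxy
      · intro x hx
        simp only [mem_insert, mem_map, Fin.coe_castSuccEmb] at hx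
        rcases hx with rfl | ⟨x, hx, rfl⟩
        · rw [appendValue_last]; omega
        · rw [appendValue_castSucc]
          have := hlt x hx
          rw [Fin.lt_def] at this
          omega
    · exact hold

theorem sum_perm_succ {n : ℕ} (f : Equiv.Perm (Fin (n + 1)) → ℝ) :
    ∑ σ, f σ = ∑ π : Equiv.Perm (Fin n), ∑ v, f (appendValue v π) := by
  rw [← (appendValue_bijective n).sum_comp, ← univ_product_univ, sum_product_right]

theorem sum_fin_depth {n : ℕ} (f : ℕ → ℝ) :
    ∑ v : Fin (n + 1), f (n - v) = ∑ g ∈ range (n + 1), f g := by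
  rw [Fin.sum_univ_eq_sum_range (fun v => f (n - v)) (n + 1), ← sum_range_reflect]
  apply sum_congr rfl
  intro x hx
  rw [mem_range] at hx
  congr 1; omega

theorem mallowsExp_profile {q : ℝ} (hq0 : 0 < q) (hq1 : q < 1) (n : ℕ) (F : (ℕ → ℕ) → ℝ) :
    mallowsExp n q (fun π => F (profile π)) = chainExp q n F := by
  induction n generalizing F with
  | zero =>
    have : profile (default : Equiv.Perm (Fin 0)) = 0 := by
      ext j
      obtain ⟨s, -, -, h3⟩ := exists_profile (default : Equiv.Perm (Fin 0)) j
      rw [← h3, eq_empty_of_isEmpty s]; rfl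
    simp only [mallowsExp, univ_unique, sum_singleton, mallowsPMF, chainExp_zero, this]
    rw [div_self (by positivity), one_mul]
  | succ n ih =>
    rw [chainExp_succ, ← ih]
    have hZ : ∀ m, (∑ σ : Equiv.Perm (Fin m), q ^ mallowsInv σ) ≠ 0 := fun m =>
      (sum_pos (fun σ _ => by positivity) univ_nonempty).ne'
    have h1 : (1 - q) ≠ 0 := by linarith
    have hG : ∑ g ∈ range (n + 1), q ^ g = (1 - q ^ (n + 1)) / (1 - q) := by
      rw [eq_div_iff h1, geom_sum_mul_neg]
    have hpw := (one_sub_pow_pos hq0 hq1 n).ne'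
    have hZs : ∑ σ : Equiv.Perm (Fin (n + 1)), q ^ mallowsInv σ =
        (∑ σ : Equiv.Perm (Fin n), q ^ mallowsInv σ) * ((1 - q ^ (n + 1)) / (1 - q)) := by
      rw [sum_perm_succ, sum_mul]
      refine sum_congr rfl fun π _ => ?_
      simp only [mallowsInv_appendValue, pow_add q (mallowsInv π)]
      rw [← mul_sum, sum_fin_depth (fun g => q ^ g), hG]
    simp only [mallowsExp, mallowsPMF]
    rw [sum_perm_succ]
    refine sum_congr rfl fun π _ => ?_
    rw [trans_apply, mul_sum,
      ← sum_fin_depth (fun g => q ^ mallowsInv π / (∑ σ : Equiv.Perm (Fin n), q ^ mallowsInv σ) *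
        (depthWeight q n g * F (depthStep g (profile π))))]
    refine sum_congr rfl fun v _ => ?_
    rw [mallowsInv_appendValue, profile_appendValue, hZs, depthWeight, pow_add]
    have := hZ n
    field_simp

theorem sum_exp_le {ι : Type*} (s : Finset ι) (w y : ι → ℝ) (c l : ℝ)
    (hw : ∀ i ∈ s, 0 ≤ w i) (hw1 : ∑ i ∈ s, w i = 1)
    (hy : ∀ i ∈ s, c ≤ y i ∧ y i ≤ c + 1) :
    ∑ i ∈ s, w i * Real.exp (l * y i) ≤
      Real.exp (l * ∑ i ∈ s, w i * y i + l ^ 2 / 2) := by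
  set m := ∑ i ∈ s, w i * y i with hm
  have hm1 : c ≤ m := by
    calc c = ∑ i ∈ s, w i * c := by rw [← sum_mul, hw1, one_mul]
      _ ≤ m := sum_le_sum fun i hi => mul_le_mul_of_nonneg_left (hy i hi).1 (hw i hi)
  have hm2 : m ≤ c + 1 := by
    calc m ≤ ∑ i ∈ s, w i * (c + 1) :=
          sum_le_sum fun i hi => mul_le_mul_of_nonneg_left (hy i hi).2 (hw i hi)
      _ = c + 1 := by rw [← sum_mul, hw1, one_mul]
  calc ∑ i ∈ s, w i * Real.exp (l * y i)
      ≤ ∑ i ∈ s, w i * (Real.exp (l * m) * (Real.cosh l + (y i - m) * Real.sinh l)) := by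
        refine sum_le_sum fun i hi => mul_le_mul_of_nonneg_left ?_ (hw i hi)
        rw [show l * y i = l * m + l * (y i - m) by ring, Real.exp_add]
        refine mul_le_mul_of_nonneg_left ?_ (Real.exp_pos _).le
        have := hy i hi
        have h := Real.exp_mul_le_cosh_add_mul_sinh (t := y i - m)
          (abs_le.2 ⟨by linarith, by linarith⟩) l
        rwa [mul_comm (y i - m) l] at h
    _ = Real.exp (l * m) * Real.cosh l := by
        have h1 : ∀ i ∈ s, w i * (Real.exp (l * m) * (Real.cosh l + (y i - m) * Real.sinh l)) =
          Real.exp (l * m) * (Real.cosh l - m * Real.sinh l) * w i +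
          Real.exp (l * m) * Real.sinh l * (w i * y i) := fun i _ => by ring
        rw [sum_congr rfl h1, sum_add_distrib, ← mul_sum, ← mul_sum, hw1, ← hm]
        ring
    _ ≤ Real.exp (l * m) * Real.exp (l ^ 2 / 2) :=
        mul_le_mul_of_nonneg_left (Real.cosh_le_exp_half_sq l) (Real.exp_pos _).le
    _ = _ := by rw [Real.exp_add]

theorem abs_rpow_le_exp {p : ℝ} (hp : 0 < p) (y : ℝ) :
    |y| ^ p ≤ p ^ p * (Real.exp y + Real.exp (-y)) := by
  have h1 : |y| / p ≤ Real.exp (|y| / p) := by linarith [Real.add_one_le_exp (|y| / p)]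
  have h2 := Real.rpow_le_rpow (by positivity) h1 hp.le
  rw [Real.div_rpow (abs_nonneg _) hp.le, ← Real.exp_mul, div_mul_cancel₀ _ hp.ne',
    div_le_iff₀ (by positivity)] at h2
  refine h2.trans ?_
  rw [mul_comm]
  refine mul_le_mul_of_nonneg_left ?_ (by positivity)
  rcases abs_cases y with ⟨h, -⟩ | ⟨h, -⟩ <;> rw [h]
  · linarith [Real.exp_pos (-y)]
  · linarith [Real.exp_pos y]

theorem add_rpow_le_two_rpow {p : ℝ} (hp : 0 < p) {x y : ℝ} (hx : 0 ≤ x) (hy : 0 ≤ y) :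
    (x + y) ^ p ≤ 2 ^ p * (x ^ p + y ^ p) := by
  have h1 : x + y ≤ 2 * max x y := by linarith [le_max_left x y, le_max_right x y]
  refine (Real.rpow_le_rpow (by positivity) h1 hp.le).trans ?_
  rw [Real.mul_rpow (by norm_num) (le_max_of_le_left hx)]
  refine mul_le_mul_of_nonneg_left ?_ (by positivity)
  have := Real.rpow_nonneg hx p
  have := Real.rpow_nonneg hy p
  rcases max_choice x y with h | h <;> rw [h] <;> linarith

section
variable {q : ℝ} (hq0 : 0 < q) (hq1 : q < 1)
include hq0 hq1

theorem chainExp_exp_le (n : ℕ) {F : (ℕ → ℕ) → ℝ} (hF : Equivariant F) (l : ℝ) :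
    chainExp q n (fun h => Real.exp (l * F h)) ≤
      Real.exp (l * chainExp q n F + n * (l ^ 2 / 2)) := by
  induction n generalizing F with
  | zero => simp [chainExp_zero]
  | succ n ih =>
    rw [chainExp_succ, chainExp_succ]
    have h1 : chainExp q n (trans q n fun h => Real.exp (l * F h)) ≤
        chainExp q n ((Real.exp (l ^ 2 / 2)) • fun h => Real.exp (l * trans q n F h)) := by
      refine chainExp_mono hq0 hq1 n fun h hh => ?_
      simp only [Pi.smul_apply, smul_eq_mul, trans_apply]
      rw [← Real.exp_add, add_comm (l ^ 2 / 2)]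
      refine sum_exp_le _ _ _ (F h) l (fun g _ => depthWeight_nonneg hq0 hq1 n g)
        (sum_depthWeight hq0 hq1 n) fun g _ => ⟨hF.mono (le_depthStep hh g), ?_⟩
      rw [← hF.add_one]
      exact hF.mono (depthStep_le hh g)
    refine h1.trans ?_
    rw [map_smul, smul_eq_mul]
    refine (mul_le_mul_of_nonneg_left (ih (hF.trans hq0 hq1 n)) (Real.exp_pos _).le).trans ?_
    rw [← Real.exp_add]
    push_cast
    exact le_of_eq (by ring_nf)

theorem chainExp_central_moment_le {n : ℕ} (hn : 0 < n) {F : (ℕ → ℕ) → ℝ} (hF : Equivariant F)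
    {p : ℝ} (hp : 0 < p) :
    chainExp q n (fun h => |F h - chainExp q n F| ^ p) ≤
      2 * Real.exp (1 / 2) * p ^ p * Real.sqrt n ^ p := by
  set m := chainExp q n F with hm
  have hs : 0 < Real.sqrt n := Real.sqrt_pos.2 (by exact_mod_cast hn)
  have hss : Real.sqrt n ^ 2 = n := Real.sq_sqrt (by positivity)
  set l := (Real.sqrt n)⁻¹ with hl
  have hl2 : n * (l ^ 2 / 2) = 1 / 2 := by
    rw [hl, inv_pow, hss]; field_simp
  have h1 : chainExp q n (fun h => |F h - m| ^ p) ≤ chainExp q n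
      ((p ^ p * Real.sqrt n ^ p * Real.exp (-(l * m))) • (fun h => Real.exp (l * F h)) +
      (p ^ p * Real.sqrt n ^ p * Real.exp (l * m)) • (fun h => Real.exp (-l * F h))) := by
    refine chainExp_mono hq0 hq1 n fun h _ => ?_
    have h2 := abs_rpow_le_exp hp (l * (F h - m))
    have h3 : |F h - m| = Real.sqrt n * |l * (F h - m)| := by
      rw [abs_mul, abs_of_pos (by positivity : 0 < l), hl]; field_simp
    rw [h3, Real.mul_rpow hs.le (abs_nonneg _)]
    refine (mul_le_mul_of_nonneg_left h2 (Real.rpow_nonneg hs.le p)).trans (le_of_eq ?_)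
    simp only [Pi.add_apply, Pi.smul_apply, smul_eq_mul]
    rw [show l * (F h - m) = -(l * m) + l * F h by ring,
      show -(-(l * m) + l * F h) = l * m + -l * F h by ring, Real.exp_add, Real.exp_add]
    ring
  refine h1.trans ?_
  rw [map_add, map_smul, map_smul, smul_eq_mul, smul_eq_mul]
  have e1 := chainExp_exp_le hq0 hq1 n hF l
  have e2 := chainExp_exp_le hq0 hq1 n hF (-l)
  rw [← hm, hl2] at e1
  rw [← hm, neg_sq, hl2] at e2
  have hc : 0 ≤ p ^ p * Real.sqrt n ^ p := by positivity
  have f1 := mul_le_mul_of_nonneg_left e1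
    (by positivity : 0 ≤ p ^ p * Real.sqrt n ^ p * Real.exp (-(l * m)))
  have f2 := mul_le_mul_of_nonneg_left e2
    (by positivity : 0 ≤ p ^ p * Real.sqrt n ^ p * Real.exp (l * m))
  rw [mul_assoc _ (Real.exp _) (Real.exp (_ + _)), ← Real.exp_add,
    show -(l * m) + (l * m + 1 / 2) = 1 / 2 by ring] at f1
  rw [mul_assoc _ (Real.exp _) (Real.exp (_ + _)), ← Real.exp_add,
    show l * m + (-l * m + 1 / 2) = 1 / 2 by ring] at f2
  linarith
end

theorem equivariant_eval (j : ℕ) : Equivariant (fun h => (h j : ℝ)) where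
  mono := fun a b hab => Nat.cast_le.2 (hab j)
  add_one := fun h => by simp

/-- Convergence of the normalized means implies convergence in every `L_p`. -/
theorem tendsto_Lp_of_tendsto_mean (q : ℕ → ℝ)
    (hq0 : ∀ n, 0 < q n) (hq1 : ∀ n, q n < 1)
    (hnq : Filter.Tendsto (fun n : ℕ => (n : ℝ) * (1 - q n)) Filter.atTop Filter.atTop)
    (hmean : Filter.Tendsto (fun n : ℕ => chainExp (q n) n (fun h => (h 0 : ℝ)) /
      ((n : ℝ) * Real.sqrt (1 - q n))) Filter.atTop (nhds 1)) (p : ℝ) (hp : 0 < p) :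
      Filter.Tendsto
        (fun n : ℕ => mallowsExp n (q n)
          (fun π => |(LIS π : ℝ) / ((n : ℝ) * Real.sqrt (1 - q n)) - 1| ^ p))
        Filter.atTop (nhds 0) := by
  have e : ∀ n : ℕ, mallowsExp n (q n)
      (fun π => |(LIS π : ℝ) / ((n : ℝ) * Real.sqrt (1 - q n)) - 1| ^ p) =
      chainExp (q n) n (fun h => |(h 0 : ℝ) / ((n : ℝ) * Real.sqrt (1 - q n)) - 1| ^ p) := by
    intro n
    rw [← mallowsExp_profile (hq0 n) (hq1 n)]
    simp only [LIS_eq_profile]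
  simp only [e]
  set K := 2 * Real.exp (1 / 2) * p ^ p with hK
  have hsq : Filter.Tendsto (fun n : ℕ => (Real.sqrt (n * (1 - q n)))⁻¹) Filter.atTop (nhds 0) :=
    (Real.tendsto_sqrt_atTop.comp hnq).inv_tendsto_atTop
  have hb : Filter.Tendsto (fun n : ℕ => 2 ^ p * (K * (Real.sqrt (n * (1 - q n)))⁻¹ ^ p +
      |chainExp (q n) n (fun h => (h 0 : ℝ)) / ((n : ℝ) * Real.sqrt (1 - q n)) - 1| ^ p))
      Filter.atTop (nhds 0) := by
    have h1 := hsq.rpow_const (p := p) (Or.inr hp.le)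
    have h2 := ((hmean.sub_const 1).abs).rpow_const (p := p) (Or.inr hp.le)
    rw [sub_self, abs_zero, Real.zero_rpow hp.ne'] at h2
    rw [Real.zero_rpow hp.ne'] at h1
    simpa using ((h1.const_mul K).add h2).const_mul ((2 : ℝ) ^ p)
  refine squeeze_zero' ?_ ?_ hb
  · refine Filter.Eventually.of_forall fun n => ?_
    rw [← chainExp_const (hq0 n) (hq1 n) n 0]
    exact chainExp_mono (hq0 n) (hq1 n) n fun h _ => Real.rpow_nonneg (abs_nonneg _) _
  · filter_upwards [Filter.eventually_gt_atTop 0] with n hn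
    have ha : 0 < Real.sqrt (1 - q n) := Real.sqrt_pos.2 (by linarith [hq1 n])
    have hn' : (0 : ℝ) < n := by exact_mod_cast hn
    set d := (n : ℝ) * Real.sqrt (1 - q n) with hd
    have hd0 : 0 < d := by positivity
    set m := chainExp (q n) n (fun h => (h 0 : ℝ)) with hm
    have h1 : chainExp (q n) n (fun h => |(h 0 : ℝ) / d - 1| ^ p) ≤
        chainExp (q n) n (fun h => ((2 ^ p * (d⁻¹) ^ p) • fun h : ℕ → ℕ => |(h 0 : ℝ) - m| ^ p) h +
          2 ^ p * |m / d - 1| ^ p) := by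
      refine chainExp_mono (hq0 n) (hq1 n) n fun h _ => ?_
      have h2 : |(h 0 : ℝ) / d - 1| ≤ d⁻¹ * |(h 0 : ℝ) - m| + |m / d - 1| := by
        have : (h 0 : ℝ) / d - 1 = d⁻¹ * ((h 0 : ℝ) - m) + (m / d - 1) := by
          field_simp; ring
        rw [this]
        refine (abs_add_le _ _).trans ?_
        rw [abs_mul, abs_of_pos (inv_pos.2 hd0)]
      refine (Real.rpow_le_rpow (abs_nonneg _) h2 hp.le).trans ?_
      refine (add_rpow_le_two_rpow hp (by positivity) (abs_nonneg _)).trans (le_of_eq ?_)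
      rw [Real.mul_rpow (by positivity) (abs_nonneg _)]
      simp only [Pi.smul_apply, smul_eq_mul]
      ring
    refine h1.trans ?_
    rw [chainExp_add_const (hq0 n) (hq1 n), map_smul, smul_eq_mul]
    have h3 := chainExp_central_moment_le (hq0 n) (hq1 n) hn (equivariant_eval 0) hp
    have h4 : d⁻¹ ^ p * Real.sqrt n ^ p = (Real.sqrt (n * (1 - q n)))⁻¹ ^ p := by
      rw [← Real.mul_rpow (by positivity) (by positivity)]
      congr 1
      rw [Real.sqrt_mul hn'.le, hd]
      have := Real.sq_sqrt hn'.le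
      field_simp
      exact this
    calc 2 ^ p * d⁻¹ ^ p * chainExp (q n) n (fun h => |(h 0 : ℝ) - m| ^ p)
          + 2 ^ p * |m / d - 1| ^ p
        ≤ 2 ^ p * d⁻¹ ^ p * (K * Real.sqrt n ^ p) + 2 ^ p * |m / d - 1| ^ p := by
          gcongr
      _ = _ := by rw [← h4]; ring

/-- Expectation over independent letters in `range K`, letter `i < N` having weights `w i`. -/
noncomputable def prodExp (K : ℕ) (w : ℕ → ℕ → ℝ) : ℕ → (((ℕ → ℕ) → ℝ) →ₗ[ℝ] ℝ)
  | 0 => LinearMap.proj 0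
  | N + 1 => ∑ x ∈ range K, w N x •
      (prodExp K w N).comp (LinearMap.funLeft ℝ ℝ fun b => Function.update b N x)

theorem prodExp_zero (K : ℕ) (w : ℕ → ℕ → ℝ) (F : (ℕ → ℕ) → ℝ) : prodExp K w 0 F = F 0 := rfl

theorem prodExp_succ (K : ℕ) (w : ℕ → ℕ → ℝ) (N : ℕ) (F : (ℕ → ℕ) → ℝ) :
    prodExp K w (N + 1) F =
      ∑ x ∈ range K, w N x * prodExp K w N (fun b => F (Function.update b N x)) := by
  simp only [prodExp, LinearMap.sum_apply, LinearMap.smul_apply, smul_eq_mul]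
  rfl

theorem prodExp_comm (K : ℕ) (w : ℕ → ℕ → ℝ) (L : ((ℕ → ℕ) → ℝ) →ₗ[ℝ] ((ℕ → ℕ) → ℝ))
    (N : ℕ) (G : (ℕ → ℕ) → (ℕ → ℕ) → ℝ) (h : ℕ → ℕ) :
    L (fun h => prodExp K w N fun b => G b h) h = prodExp K w N fun b => L (G b) h := by
  induction N generalizing G with
  | zero => rfl
  | succ N ih =>
    have : (fun h => prodExp K w (N + 1) fun b => G b h) =
        ∑ x ∈ range K, w N x • fun h => prodExp K w N fun b => G (Function.update b N x) h := by
      ext h; simp [prodExp_succ]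
    rw [this, map_sum, prodExp_succ, Finset.sum_apply]
    refine sum_congr rfl fun x _ => ?_
    rw [map_smul, Pi.smul_apply, smul_eq_mul, ih]

theorem update_lt {K : ℕ} {b : ℕ → ℕ} (hb : ∀ i, b i < K) {x : ℕ} (hx : x < K) (N : ℕ) :
    ∀ i, Function.update b N x i < K := by
  intro i
  by_cases h : i = N
  · subst h; simpa
  · rw [Function.update_of_ne h]; exact hb i

section
variable {K : ℕ} {w : ℕ → ℕ → ℝ} (hK : 0 < K) (hw : ∀ i x, 0 ≤ w i x)
  (hw1 : ∀ i, ∑ x ∈ range K, w i x = 1)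

include hK hw in
theorem prodExp_mono (N : ℕ) {F G : (ℕ → ℕ) → ℝ} (hFG : ∀ b, (∀ i, b i < K) → F b ≤ G b) :
    prodExp K w N F ≤ prodExp K w N G := by
  induction N generalizing F G with
  | zero => exact hFG _ fun _ => hK
  | succ N ih =>
    rw [prodExp_succ, prodExp_succ]
    refine sum_le_sum fun x hx => mul_le_mul_of_nonneg_left (ih fun b hb => ?_) (hw N x)
    exact hFG _ (update_lt hb (mem_range.1 hx) N)

include hw1 in
theorem prodExp_const (N : ℕ) (c : ℝ) : prodExp K w N (fun _ => c) = c := by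
  induction N with
  | zero => rfl
  | succ N ih => rw [prodExp_succ]; simp only [ih]; rw [← sum_mul, hw1, one_mul]

include hw1 in
theorem prodExp_succ_of_indep (N : ℕ) {F : (ℕ → ℕ) → ℝ}
    (hF : ∀ b x, F (Function.update b N x) = F b) :
    prodExp K w (N + 1) F = prodExp K w N F := by
  rw [prodExp_succ]; simp only [hF]; rw [← sum_mul, hw1, one_mul]

include hK hw in
/-- Inequalities may be checked after averaging over a single letter. -/
theorem prodExp_le_of_letter (N : ℕ) {i : ℕ} (hi : i < N) {F G : (ℕ → ℕ) → ℝ}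
    (hFG : ∀ b, (∀ i, b i < K) → ∑ x ∈ range K, w i x * F (Function.update b i x) ≤
      ∑ x ∈ range K, w i x * G (Function.update b i x)) :
    prodExp K w N F ≤ prodExp K w N G := by
  induction N generalizing F G with
  | zero => omega
  | succ N ih =>
    rcases Nat.lt_succ_iff_lt_or_eq.1 hi with hi' | rfl
    · rw [prodExp_succ, prodExp_succ]
      refine sum_le_sum fun x hx => mul_le_mul_of_nonneg_left (ih hi' fun b hb => ?_) (hw N x)
      have := hFG _ (update_lt hb (mem_range.1 hx) N)
      simp only [fun y => Function.update_comm hi'.ne y x b]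
      exact this
    · have e : ∀ F : (ℕ → ℕ) → ℝ, prodExp K w (i + 1) F = prodExp K w i
          (fun b => ∑ x ∈ range K, w i x * F (Function.update b i x)) := by
        intro F
        have : (fun b => ∑ x ∈ range K, w i x * F (Function.update b i x)) =
            ∑ x ∈ range K, w i x • fun b => F (Function.update b i x) := by
          ext b; simp
        rw [this, map_sum, prodExp_succ]
        exact sum_congr rfl fun x _ => by rw [map_smul, smul_eq_mul]
      rw [e, e]
      exact prodExp_mono hK hw i hFG

include hK hw in
/-- Coordinatewise stochastic domination. -/
theorem prodExp_le_of_dominated {w' : ℕ → ℕ → ℝ} (hw' : ∀ i x, 0 ≤ w' i x)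
    (hww' : ∀ (i : ℕ) (f : ℕ → ℝ), Monotone f →
      ∑ x ∈ range K, w i x * f x ≤ ∑ x ∈ range K, w' i x * f x)
    (N : ℕ) {F : (ℕ → ℕ) → ℝ} (hF : Monotone F) : prodExp K w N F ≤ prodExp K w' N F := by
  induction N generalizing F with
  | zero => exact le_rfl
  | succ N ih =>
    rw [prodExp_succ, prodExp_succ]
    have hm : ∀ x, Monotone fun b => F (Function.update b N x) := by
      intro x a b hab
      apply hF
      exact update_le_update_iff.2 ⟨le_rfl, fun j _ => hab j⟩
    calc _ ≤ ∑ x ∈ range K, w N x * prodExp K w' N (fun b => F (Function.update b N x)) :=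
          sum_le_sum fun x _ => mul_le_mul_of_nonneg_left (ih (hm x)) (hw N x)
      _ ≤ _ := by
        apply hww' N (fun x => prodExp K w' N (fun b => F (Function.update b N x)))
        intro x y hxy
        refine prodExp_mono hK hw' N fun b _ => hF ?_
        exact update_le_update_iff.2 ⟨hxy, fun j _ => le_rfl⟩
end

open Classical in
/-- Indicator of a proposition. -/
noncomputable def ind (P : Prop) : ℝ := if P then 1 else 0

theorem ind_nonneg (P : Prop) : 0 ≤ ind P := by unfold ind; split_ifs <;> norm_num

theorem ind_le_one (P : Prop) : ind P ≤ 1 := by unfold ind; split_ifs <;> norm_num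

theorem ind_of {P : Prop} (h : P) : ind P = 1 := if_pos h

theorem ind_of_not {P : Prop} (h : ¬P) : ind P = 0 := if_neg h

theorem ind_le_ind {P Q : Prop} (h : P → Q) : ind P ≤ ind Q := by
  by_cases hP : P
  · rw [ind_of hP, ind_of (h hP)]
  · rw [ind_of_not hP]; exact ind_nonneg Q

theorem sum_ind_le_one {ι : Type*} (s : Finset ι) (P : ι → Prop)
    (h : ∀ i ∈ s, ∀ j ∈ s, P i → P j → i = j) : ∑ i ∈ s, ind (P i) ≤ 1 := by
  by_cases hex : ∃ i ∈ s, P i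
  · obtain ⟨i, hi, hPi⟩ := hex
    rw [sum_eq_single_of_mem i hi fun j hj hji => ind_of_not fun hP => hji (h j hj i hi hP hPi)]
    exact ind_le_one _
  · push Not at hex
    rw [sum_eq_zero fun i hi => ind_of_not (hex i hi)]
    norm_num

/-- Profile plus partial sums of a word. -/
def walk (h b : ℕ → ℕ) (j : ℕ) : ℕ := h j + ∑ i ∈ range j, b i

/-- Maximum of the walk on `{0, …, t}`. -/
def walkMax (h b : ℕ → ℕ) (t : ℕ) : ℕ := (range (t + 1)).sup (walk h b)

theorem walk_le_walkMax (h b : ℕ → ℕ) {j t : ℕ} (hj : j ≤ t) : walk h b j ≤ walkMax h b t :=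
  le_sup (f := walk h b) (mem_range.2 (by omega))

theorem exists_walkMax (h b : ℕ → ℕ) (t : ℕ) : ∃ j ≤ t, walkMax h b t = walk h b j := by
  obtain ⟨j, hj, hj'⟩ := exists_mem_eq_sup (range (t + 1)) ⟨0, by simp⟩ (walk h b)
  exact ⟨j, by rw [mem_range] at hj; omega, hj'⟩

theorem walkMax_mono {h h' b b' : ℕ → ℕ} (hh : h ≤ h') (hb : b ≤ b') (t : ℕ) :
    walkMax h b t ≤ walkMax h' b' t := by
  refine Finset.sup_mono_fun fun j _ => ?_
  exact add_le_add (hh j) (sum_le_sum fun i _ => hb i)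

theorem walk_update (h b : ℕ → ℕ) (j x k : ℕ) :
    walk h (Function.update b j x) k =
      walk h (Function.update b j 0) k + if j < k then x else 0 := by
  unfold walk
  rw [add_assoc]
  congr 1
  by_cases hjk : j < k
  · rw [if_pos hjk, sum_update_of_mem (mem_range.2 hjk), sum_update_of_mem (mem_range.2 hjk)]
    omega
  · rw [if_neg hjk, sum_update_of_notMem (by simpa using hjk),
      sum_update_of_notMem (by simpa using hjk), add_zero]

theorem walkMax_depthStep_le {h b : ℕ → ℕ} (hh : IsProfile h) (hb : ∀ i, b i < 3) {G t : ℕ}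
    (hG : G ≤ t) : (walkMax (depthStep G h) b (t + 1) : ℝ) ≤ walkMax h b t +
      ind (∀ k ≤ t, walk h b k ≤ walk h b G) +
      ∑ i ∈ range (t + 1),
        (if G ≤ i then ind (∀ k ≤ t, walk h b k + 1 ≤ walk h b i + b i) else 0) +
      ind (b t = 2) := by
  have hnn : ∀ i ∈ range (t + 1), (0 : ℝ) ≤
      (if G ≤ i then ind (∀ k ≤ t, walk h b k + 1 ≤ walk h b i + b i) else 0) := by
    intro i _
    split_ifs
    · exact ind_nonneg _
    · exact le_rfl
  obtain ⟨j, hj, hj'⟩ := exists_walkMax (depthStep G h) b (t + 1)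
  obtain ⟨m, hm, hm'⟩ := exists_walkMax h b t
  have n1 := ind_nonneg (∀ k ≤ t, walk h b k ≤ walk h b G)
  have n2 := ind_nonneg (b t = 2)
  have n3 := sum_nonneg hnn
  have hGle : (walk h b G : ℝ) + 1 ≤ walkMax h b t +
      ind (∀ k ≤ t, walk h b k ≤ walk h b G) := by
    by_cases hA : ∀ k ≤ t, walk h b k ≤ walk h b G
    · rw [ind_of hA]
      have : (walk h b G : ℝ) ≤ walkMax h b t := by exact_mod_cast walk_le_walkMax h b hG
      linarith
    · rw [ind_of_not hA, add_zero]
      push Not at hA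
      obtain ⟨k, hk, hk'⟩ := hA
      have := walk_le_walkMax h b hk
      exact_mod_cast (show walk h b G + 1 ≤ walkMax h b t by omega)
  rw [hj']
  by_cases hjG : j ≤ G
  · have h1 : walk (depthStep G h) b j ≤ max (walkMax h b t) (walk h b G + 1) := by
      have h2 : ∑ i ∈ range j, b i ≤ ∑ i ∈ range G, b i :=
        sum_le_sum_of_subset (range_mono hjG)
      have h3 := walk_le_walkMax h b (hjG.trans hG)
      unfold walk at h3 ⊢
      rw [depthStep, if_pos hjG]
      omega
    have h2 : (walk (depthStep G h) b j : ℝ) ≤ max (walkMax h b t : ℝ) (walk h b G + 1) := by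
      exact_mod_cast h1
    rcases max_choice (walkMax h b t : ℝ) (walk h b G + 1) with h3 | h3 <;> rw [h3] at h2 <;>
      linarith
  · obtain ⟨i, rfl⟩ : ∃ i, j = i + 1 := ⟨j - 1, by omega⟩
    have hit : i ≤ t := by omega
    have h1 : walk (depthStep G h) b (i + 1) = walk h b i + b i := by
      unfold walk
      rw [depthStep, if_neg hjG, sum_range_succ, Nat.add_sub_cancel, add_assoc]
    rw [h1]
    have hwi := walk_le_walkMax h b hit
    by_cases hbad : ∀ k ≤ t, walk h b k + 1 ≤ walk h b i + b i
    · have h4 : (1 : ℝ) ≤ ∑ i ∈ range (t + 1),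
          (if G ≤ i then ind (∀ k ≤ t, walk h b k + 1 ≤ walk h b i + b i) else 0) := by
        refine le_trans (le_of_eq ?_) (single_le_sum hnn (mem_range.2 (by omega : i < t + 1)))
        rw [if_pos (by omega), ind_of hbad]
      have h5 : (walk h b i + b i : ℕ) ≤ (walkMax h b t : ℝ) + 1 + ind (b t = 2) := by
        rcases Nat.lt_or_eq_of_le hit with hlt | rfl
        · have h6 := walk_le_walkMax h b (show i + 1 ≤ t from hlt)
          have h7 := hh.2 i
          have h8 : walk h b i + b i ≤ walkMax h b t + 1 := by
            unfold walk at h6 ⊢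
            rw [sum_range_succ] at h6
            omega
          have h9 : ((walk h b i + b i : ℕ) : ℝ) ≤ walkMax h b t + 1 := by exact_mod_cast h8
          linarith
        · by_cases h2 : b i = 2
          · rw [ind_of h2, h2]
            push_cast
            have : (walk h b i : ℝ) ≤ walkMax h b i := by exact_mod_cast hwi
            linarith
          · rw [ind_of_not h2]
            have := hb i
            have h8 : walk h b i + b i ≤ walkMax h b i + 1 := by omega
            rw [add_zero]
            exact_mod_cast h8
      linarith
    · push Not at hbad
      obtain ⟨k, hk, hk'⟩ := hbad
      have h6 := walk_le_walkMax h b hk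
      have h8 : ((walk h b i + b i : ℕ) : ℝ) ≤ walkMax h b t := by
        exact_mod_cast (show walk h b i + b i ≤ walkMax h b t by omega)
      linarith

/-- Letter weights proportional to `1, θ i, θ i ^ 2`. -/
noncomputable def triWeight (θ : ℕ → ℝ) (i x : ℕ) : ℝ := θ i ^ x / (1 + θ i + θ i ^ 2)

section tri
variable {θ : ℕ → ℝ} (hθ : ∀ i, 0 < θ i)
include hθ

theorem triWeight_nonneg (i x : ℕ) : 0 ≤ triWeight θ i x := by
  have := hθ i
  unfold triWeight; positivity

theorem sum_triWeight (i : ℕ) : ∑ x ∈ range 3, triWeight θ i x = 1 := by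
  have := hθ i
  simp only [triWeight, sum_range_succ, range_zero, sum_empty, zero_add]
  rw [← add_div, ← add_div]
  rw [div_eq_one_iff_eq (by positivity)]
  ring

omit hθ in
theorem triWeight_succ (i x : ℕ) : triWeight θ i (x + 1) = θ i * triWeight θ i x := by
  unfold triWeight; ring

theorem triWeight_zero_le (i : ℕ) : triWeight θ i 0 ≤ 1 := by
  have := hθ i
  unfold triWeight
  rw [div_le_one (by positivity), pow_zero]
  nlinarith

/-- Mean of the maximal walk, the potential function for the upper bound. -/
noncomputable def potential (θ : ℕ → ℝ) (t : ℕ) (h : ℕ → ℕ) : ℝ :=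
  prodExp 3 (triWeight θ) t fun b => walkMax h b t

theorem le_potential (t : ℕ) (h : ℕ → ℕ) : (h 0 : ℝ) ≤ potential θ t h := by
  rw [← prodExp_const (sum_triWeight hθ) t (h 0 : ℝ)]
  refine prodExp_mono (by norm_num) (triWeight_nonneg hθ) t fun b _ => ?_
  have := walk_le_walkMax h b (Nat.zero_le t)
  simp only [walk, range_zero, sum_empty, add_zero] at this
  exact_mod_cast this

theorem potential_le_of_le {θ' : ℕ → ℝ} (hle : ∀ i, θ i ≤ θ' i) (t : ℕ) (h : ℕ → ℕ) :
    potential θ t h ≤ potential θ' t h := by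
  have hθ' : ∀ i, 0 < θ' i := fun i => (hθ i).trans_le (hle i)
  refine prodExp_le_of_dominated (by norm_num) (triWeight_nonneg hθ) (triWeight_nonneg hθ')
    ?_ t fun a b hab => Nat.cast_le.2 (walkMax_mono le_rfl hab t)
  intro i f hf
  have h0 := hθ i
  have h0' := hθ' i
  have hl := hle i
  have f1 := hf (show 0 ≤ 1 by norm_num)
  have f2 := hf (show 1 ≤ 2 by norm_num)
  simp only [triWeight, sum_range_succ, range_zero, sum_empty, zero_add, pow_zero, pow_one]
  have e : ∀ x : ℝ, 0 < x → 1 / (1 + x + x ^ 2) * f 0 + x / (1 + x + x ^ 2) * f 1 +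
      x ^ 2 / (1 + x + x ^ 2) * f 2 =
      f 0 + (f 1 - f 0) * (1 - 1 / (1 + x + x ^ 2)) +
        (f 2 - f 1) * (x ^ 2 / (1 + x + x ^ 2)) := by
    intro x hx
    field_simp
    ring
  rw [e _ h0, e _ h0']
  have m1 : 1 / (1 + θ' i + θ' i ^ 2) ≤ 1 / (1 + θ i + θ i ^ 2) := by
    apply one_div_le_one_div_of_le (by positivity)
    gcongr
  have m2 : θ i ^ 2 / (1 + θ i + θ i ^ 2) ≤ θ' i ^ 2 / (1 + θ' i + θ' i ^ 2) := by
    rw [div_le_div_iff₀ (by positivity) (by positivity)]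
    have : θ i * θ i ≤ θ' i * θ' i := by gcongr
    have : θ i * θ i * θ' i ≤ θ' i * θ' i * θ i := by nlinarith [mul_pos h0 h0']
    nlinarith
  have := mul_le_mul_of_nonneg_left m1 (sub_nonneg.2 f1)
  have := mul_le_mul_of_nonneg_left m2 (sub_nonneg.2 f2)
  linarith

/-- `P(walk is maximal at j+1)` is controlled by `P(first maximum at j+1)`. -/
theorem letter_raise {t j : ℕ} (hj : j ≤ t) (h : ℕ → ℕ) {v A : ℝ} (hv : 0 ≤ v)
    (hA : v ≤ A * θ j) (hA0 : 0 ≤ A) :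
    v * prodExp 3 (triWeight θ) (t + 1) (fun b => ind (∀ k ≤ t, walk h b k ≤ walk h b (j + 1))) ≤
      A * prodExp 3 (triWeight θ) (t + 1) (fun b => ind ((∀ k ≤ t, walk h b k ≤ walk h b (j + 1)) ∧
        ∀ k < j + 1, walk h b k < walk h b (j + 1))) + v * θ j ^ 2 := by
  have e2 : v * θ j ^ 2 = prodExp 3 (triWeight θ) (t + 1) (fun _ => v * θ j ^ 2) :=
    (prodExp_const (sum_triWeight hθ) _ _).symm
  rw [← smul_eq_mul, ← map_smul, e2, ← smul_eq_mul A, ← map_smul, ← map_add]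
  refine prodExp_le_of_letter (by norm_num) (triWeight_nonneg hθ) _ (Nat.lt_succ_of_le hj) ?_
  intro b _
  have key : ∀ x, (∀ k ≤ t, walk h (Function.update b j x) k ≤
      walk h (Function.update b j x) (j + 1)) →
      ((∀ k ≤ t, walk h (Function.update b j (x + 1)) k ≤
      walk h (Function.update b j (x + 1)) (j + 1)) ∧
        ∀ k < j + 1, walk h (Function.update b j (x + 1)) k <
          walk h (Function.update b j (x + 1)) (j + 1)) := by
    intro x hx
    have hx' : ∀ k ≤ t, _ := fun k hk => by
      have := hx k hk
      rw [walk_update h b j x k, walk_update h b j x (j + 1), if_pos (Nat.lt_succ_self j)] at this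
      exact this
    constructor
    · intro k hk
      have := hx' k hk
      rw [walk_update h b j (x + 1) k, walk_update h b j (x + 1) (j + 1),
        if_pos (Nat.lt_succ_self j)]
      split_ifs at this ⊢ <;> omega
    · intro k hk
      have := hx' k (by omega)
      rw [walk_update h b j (x + 1) k, walk_update h b j (x + 1) (j + 1),
        if_pos (Nat.lt_succ_self j), if_neg (by omega)]
      rw [if_neg (by omega)] at this
      omega
  have k0 := ind_le_ind (key 0)
  have k1 := ind_le_ind (key 1)
  have t0 := triWeight_nonneg hθ j 0
  have t1 := triWeight_nonneg hθ j 1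
  have t2 := triWeight_nonneg hθ j 2
  have s1 : triWeight θ j 1 = θ j * triWeight θ j 0 := triWeight_succ j 0
  have s2 : triWeight θ j 2 = θ j * triWeight θ j 1 := triWeight_succ j 1
  have hs := sum_triWeight hθ j
  have hz := triWeight_zero_le hθ j
  simp only [sum_range_succ, range_zero, sum_empty, zero_add, Pi.smul_apply, Pi.add_apply,
    smul_eq_mul] at hs k0 k1 ⊢
  have i0 := ind_nonneg (∀ k ≤ t, walk h (Function.update b j 0) k ≤
      walk h (Function.update b j 0) (j + 1))
  have i1 := ind_nonneg (∀ k ≤ t, walk h (Function.update b j 1) k ≤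
      walk h (Function.update b j 1) (j + 1))
  have i2 := ind_le_one (∀ k ≤ t, walk h (Function.update b j 2) k ≤
      walk h (Function.update b j 2) (j + 1))
  have i3 := ind_nonneg (∀ k ≤ t, walk h (Function.update b j 2) k ≤
      walk h (Function.update b j 2) (j + 1))
  have j0 := ind_nonneg ((∀ k ≤ t, walk h (Function.update b j 0) k ≤
      walk h (Function.update b j 0) (j + 1)) ∧
        ∀ k < j + 1, walk h (Function.update b j 0) k < walk h (Function.update b j 0) (j + 1))
  generalize ind (∀ k ≤ t, walk h (Function.update b j 0) k ≤
      walk h (Function.update b j 0) (j + 1)) = f0 at *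
  generalize ind (∀ k ≤ t, walk h (Function.update b j 1) k ≤
      walk h (Function.update b j 1) (j + 1)) = f1 at *
  generalize ind (∀ k ≤ t, walk h (Function.update b j 2) k ≤
      walk h (Function.update b j 2) (j + 1)) = f2 at *
  have hθj := hθ j
  generalize ind (_ ∧ _) = g0 at *
  generalize ind (_ ∧ _) = g1 at *
  generalize ind (_ ∧ _) = g2 at *
  have a0 : triWeight θ j 0 * (v * f0) ≤ triWeight θ j 1 * (A * g1) := by
    rw [s1]
    calc triWeight θ j 0 * (v * f0) ≤ triWeight θ j 0 * (A * θ j * g1) := by gcongr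
      _ = _ := by ring
  have a1 : triWeight θ j 1 * (v * f1) ≤ triWeight θ j 2 * (A * g2) := by
    rw [s2]
    calc triWeight θ j 1 * (v * f1) ≤ triWeight θ j 1 * (A * θ j * g2) := by gcongr
      _ = _ := by ring
  have a2 : triWeight θ j 2 * (v * f2) ≤ v * θ j ^ 2 := by
    rw [s2, s1]
    calc θ j * (θ j * triWeight θ j 0) * (v * f2) ≤ θ j * (θ j * 1) * (v * 1) := by gcongr
      _ = _ := by ring
  have a3 : 0 ≤ triWeight θ j 0 * (A * g0) := by positivity
  have a4 : (triWeight θ j 0 + triWeight θ j 1 + triWeight θ j 2) * (v * θ j ^ 2) =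
    v * θ j ^ 2 := by rw [hs, one_mul]
  nlinarith

end tri
section tri
variable {θ : ℕ → ℝ} (hθ : ∀ i, 0 < θ i)
include hθ

/-- A letter producing a new maximum is charged to a last maximum, or last near-maximum. -/
theorem letter_lower {t i : ℕ} (hi : i ≤ t) (h : ℕ → ℕ) {c A B : ℝ} (hc : 0 ≤ c)
    (hA : c * θ i ≤ A) (hB : c * θ i ^ 2 ≤ B) :
    c * prodExp 3 (triWeight θ) (t + 1)
      (fun b => ind (∀ k ≤ t, walk h b k + 1 ≤ walk h b i + b i)) ≤
      (A + B) * prodExp 3 (triWeight θ) (t + 1) (fun b => ind ((∀ k ≤ t, walk h b k ≤ walk h b i) ∧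
        ∀ k ≤ t, i < k → walk h b k < walk h b i)) +
      B * prodExp 3 (triWeight θ) (t + 1) (fun b => ind ((∀ k ≤ t, walk h b k ≤ walk h b i + 1) ∧
        ∃ m ≤ t, ∀ k ≤ t, i < k → walk h b k + 1 < walk h b m)) := by
  have hθi := hθ i
  have hB0 : 0 ≤ B := le_trans (by positivity) hB
  have hA0 : 0 ≤ A := le_trans (by positivity) hA
  rw [← smul_eq_mul, ← map_smul, ← smul_eq_mul (A + B), ← map_smul, ← smul_eq_mul B,
    ← map_smul, ← map_add]
  refine prodExp_le_of_letter (by norm_num) (triWeight_nonneg hθ) _ (Nat.lt_succ_of_le hi) ?_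
  intro b _
  set Y := walk h (Function.update b i 0) with hY
  have hw : ∀ x k, walk h (Function.update b i x) k = Y k + if i < k then x else 0 :=
    fun x k => walk_update h b i x k
  have ev : ∀ x, Function.update b i x i = x := fun x => Function.update_self ..
  have f0 : ind (∀ k ≤ t, walk h (Function.update b i 0) k + 1 ≤
      walk h (Function.update b i 0) i + Function.update b i 0 i) = 0 := by
    apply ind_of_not
    intro H
    have := H i hi
    rw [ev] at this
    omega
  have f1 : ind (∀ k ≤ t, walk h (Function.update b i 1) k + 1 ≤
      walk h (Function.update b i 1) i + Function.update b i 1 i) ≤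
      ind ((∀ k ≤ t, Y k ≤ Y i) ∧ ∀ k ≤ t, i < k → Y k < Y i) := by
    apply ind_le_ind
    intro H
    simp only [hw, ev, lt_self_iff_false, if_false] at H
    constructor
    · intro k hk
      have := H k hk
      split_ifs at this <;> omega
    · intro k hk hik
      have := H k hk
      rw [if_pos hik] at this
      omega
  have f2 : ind (∀ k ≤ t, walk h (Function.update b i 2) k + 1 ≤
      walk h (Function.update b i 2) i + Function.update b i 2 i) ≤
      ind ((∀ k ≤ t, Y k ≤ Y i) ∧ ∀ k ≤ t, i < k → Y k < Y i) +
      ind ((∀ k ≤ t, Y k ≤ Y i + 1) ∧ ∃ m ≤ t, ∀ k ≤ t, i < k → Y k + 1 < Y m) := by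
    by_cases H : ∀ k ≤ t, walk h (Function.update b i 2) k + 1 ≤
      walk h (Function.update b i 2) i + Function.update b i 2 i
    · simp only [hw, ev, lt_self_iff_false, if_false] at H
      by_cases hm : ∃ m ≤ t, Y m = Y i + 1
      · obtain ⟨m, hm, hm'⟩ := hm
        refine (ind_le_one _).trans ?_
        rw [ind_of (P := (∀ k ≤ t, Y k ≤ Y i + 1) ∧ _)]
        · linarith [ind_nonneg ((∀ k ≤ t, Y k ≤ Y i) ∧ ∀ k ≤ t, i < k → Y k < Y i)]
        · refine ⟨fun k hk => ?_, m, hm, fun k hk hik => ?_⟩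
          · have := H k hk
            split_ifs at this <;> omega
          · have := H k hk
            rw [if_pos hik] at this
            omega
      · push Not at hm
        refine (ind_le_one _).trans ?_
        rw [ind_of (P := (∀ k ≤ t, Y k ≤ Y i) ∧ _)]
        · linarith [ind_nonneg ((∀ k ≤ t, Y k ≤ Y i + 1) ∧
            ∃ m ≤ t, ∀ k ≤ t, i < k → Y k + 1 < Y m)]
        · refine ⟨fun k hk => ?_, fun k hk hik => ?_⟩
          · have := H k hk
            have := hm k hk
            split_ifs at * <;> omega
          · have := H k hk
            rw [if_pos hik] at this
            omega
    · rw [ind_of_not H]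
      exact add_nonneg (ind_nonneg _) (ind_nonneg _)
  have t0 := triWeight_nonneg hθ i 0
  have t1 := triWeight_nonneg hθ i 1
  have t2 := triWeight_nonneg hθ i 2
  have s1 : triWeight θ i 1 = θ i * triWeight θ i 0 := triWeight_succ i 0
  have s2 : triWeight θ i 2 = θ i * triWeight θ i 1 := triWeight_succ i 1
  have nn : ∀ (x : ℕ) (P Q : Prop), 0 ≤ triWeight θ i x * ((A + B) * ind P + B * ind Q) :=
    fun x P Q => mul_nonneg (triWeight_nonneg hθ i x) (add_nonneg
      (mul_nonneg (by linarith) (ind_nonneg _)) (mul_nonneg hB0 (ind_nonneg _)))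
  simp only [sum_range_succ, range_zero, sum_empty, zero_add, Pi.smul_apply, Pi.add_apply,
    smul_eq_mul]
  rw [f0]
  rw [← hY]
  refine le_trans ?_ (le_add_of_nonneg_right (nn 2 _ _))
  refine le_trans ?_ (le_add_of_nonneg_right (nn 1 _ _))
  have j1 := ind_nonneg ((∀ k ≤ t, Y k ≤ Y i) ∧ ∀ k ≤ t, i < k → Y k < Y i)
  have j2 := ind_nonneg ((∀ k ≤ t, Y k ≤ Y i + 1) ∧ ∃ m ≤ t, ∀ k ≤ t, i < k → Y k + 1 < Y m)
  generalize ind ((∀ k ≤ t, Y k ≤ Y i) ∧ ∀ k ≤ t, i < k → Y k < Y i) = g1 at *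
  generalize ind ((∀ k ≤ t, Y k ≤ Y i + 1) ∧ ∃ m ≤ t, ∀ k ≤ t, i < k → Y k + 1 < Y m) = g2 at *
  have a1 := mul_le_mul_of_nonneg_left f1 (mul_nonneg t1 hc)
  have a2 := mul_le_mul_of_nonneg_left f2 (mul_nonneg t2 hc)
  have b1 : triWeight θ i 1 * c * g1 ≤ triWeight θ i 0 * (A * g1) := by
    rw [s1]
    calc θ i * triWeight θ i 0 * c * g1 = triWeight θ i 0 * (c * θ i * g1) := by ring
      _ ≤ _ := by gcongr
  have b2 : triWeight θ i 2 * c * (g1 + g2) ≤ triWeight θ i 0 * (B * (g1 + g2)) := by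
    rw [s2, s1]
    calc θ i * (θ i * triWeight θ i 0) * c * (g1 + g2) =
          triWeight θ i 0 * (c * θ i ^ 2 * (g1 + g2)) := by ring
      _ ≤ _ := by gcongr
  nlinarith

/-- One-step drift of the potential. -/
theorem trans_potential_le {q : ℝ} (hq0 : 0 < q) (hq1 : q < 1) {t : ℕ} {A B D : ℝ}
    (hA0 : 0 ≤ A)
    (hA : ∀ j < t, depthWeight q t (j + 1) ≤ A * θ j)
    (hB : ∀ i ≤ t, (1 - q ^ (i + 1)) / (1 - q ^ (t + 1)) * θ i ≤ B)
    (hD : ∀ i ≤ t, θ i ^ 2 ≤ D) {h : ℕ → ℕ} (hh : IsProfile h) :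
    trans q t (potential θ (t + 1)) h ≤
      potential θ t h + depthWeight q t 0 + A + B + 4 * D := by
  set E := prodExp 3 (triWeight θ) (t + 1) with hE
  have hD0 : 0 ≤ D := le_trans (sq_nonneg _) (hD 0 (Nat.zero_le t))
  have hpos := one_sub_pow_pos hq0 hq1 t
  have hB0 : 0 ≤ B := le_trans (mul_nonneg (div_nonneg
    (one_sub_pow_pos hq0 hq1 0).le hpos.le) (hθ 0).le) (hB 0 (Nat.zero_le t))
  have hK : 0 < 3 := by norm_num
  have hdw := depthWeight_nonneg hq0 hq1 t
  -- the four contributions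
  set F0 : (ℕ → ℕ) → ℝ := fun b => walkMax h b t
  set F1 : ℕ → (ℕ → ℕ) → ℝ := fun G b => ind (∀ k ≤ t, walk h b k ≤ walk h b G)
  set F2 : ℕ → (ℕ → ℕ) → ℝ := fun i b => ind (∀ k ≤ t, walk h b k + 1 ≤ walk h b i + b i)
  set F3 : (ℕ → ℕ) → ℝ := fun b => ind (b t = 2)
  have hswap : trans q t (potential θ (t + 1)) h =
      E (fun b => trans q t (fun h => (walkMax h b (t + 1) : ℝ)) h) :=
    prodExp_comm 3 (triWeight θ) (trans q t) (t + 1) (fun b h => (walkMax h b (t + 1) : ℝ)) h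
  have hpt : E (fun b => trans q t (fun h => (walkMax h b (t + 1) : ℝ)) h) ≤
      E (F0 + ∑ G ∈ range (t + 1), depthWeight q t G • F1 G +
        ∑ i ∈ range (t + 1), (∑ G ∈ range (i + 1), depthWeight q t G) • F2 i + F3) := by
    refine prodExp_mono hK (triWeight_nonneg hθ) _ fun b hb => ?_
    rw [trans_apply]
    refine (sum_le_sum fun G hG => mul_le_mul_of_nonneg_left (walkMax_depthStep_le hh hb
      (Nat.lt_succ_iff.1 (mem_range.1 hG))) (hdw G)).trans (le_of_eq ?_)
    simp only [mul_add, sum_add_distrib, ← sum_mul, sum_depthWeight hq0 hq1, one_mul,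
      Pi.add_apply, Finset.sum_apply, Pi.smul_apply, smul_eq_mul]
    congr 2
    simp only [mul_sum]
    rw [sum_comm]
    refine sum_congr rfl fun i hi => ?_
    simp only [mul_ite, mul_zero]
    rw [← sum_filter, sum_mul]
    refine sum_congr ?_ fun _ _ => rfl
    ext G
    simp only [mem_filter, mem_range] at *
    omega
  rw [hswap]
  refine hpt.trans ?_
  simp only [map_add, map_sum, map_smul, smul_eq_mul]
  have e0 : E F0 = potential θ t h := by
    refine prodExp_succ_of_indep (sum_triWeight hθ) t fun b x => ?_
    simp only [F0, walkMax]
    congr 1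
    refine sup_congr rfl fun k hk => ?_
    rw [mem_range] at hk
    rw [walk_update h b t x, ← Function.update_eq_self t b, Function.update_idem,
      walk_update h b t (b t), if_neg (by omega)]
    simp [if_neg (show ¬ t < k by omega)]
  have e3 : E F3 ≤ D := by
    rw [← prodExp_const (sum_triWeight hθ) (t + 1) D]
    refine prodExp_le_of_letter hK (triWeight_nonneg hθ) _ (Nat.lt_succ_self t) fun b _ => ?_
    rw [← sum_mul, sum_triWeight hθ, one_mul]
    have i0 : F3 (Function.update b t 0) = 0 := ind_of_not (by simp)
    have i1 : F3 (Function.update b t 1) = 0 := ind_of_not (by simp)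
    have i2 : F3 (Function.update b t 2) = 1 := ind_of (by simp)
    simp only [sum_range_succ, range_zero, sum_empty, zero_add, i0, i1, i2, mul_zero, mul_one]
    rw [triWeight_succ, triWeight_succ, ← mul_assoc, ← sq]
    have := hθ t
    calc θ t ^ 2 * triWeight θ t 0 ≤ θ t ^ 2 * 1 := by
          gcongr; exact triWeight_zero_le hθ t
      _ ≤ D := by rw [mul_one]; exact hD t le_rfl
  have hEle : ∀ (s : Finset ℕ) (P : ℕ → (ℕ → ℕ) → Prop),
      (∀ b, ∀ i ∈ s, ∀ j ∈ s, P i b → P j b → i = j) →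
      ∑ i ∈ s, E (fun b => ind (P i b)) ≤ 1 := by
    intro s P hP
    rw [← map_sum, ← prodExp_const (sum_triWeight hθ) (t + 1) 1]
    refine prodExp_mono hK (triWeight_nonneg hθ) _ fun b _ => ?_
    rw [Finset.sum_apply]
    exact sum_ind_le_one s (fun i => P i b) (hP b)
  have e1 : ∑ G ∈ range (t + 1), depthWeight q t G * E (F1 G) ≤ depthWeight q t 0 + A + D := by
    rw [sum_range_succ']
    have h0 : depthWeight q t 0 * E (F1 0) ≤ depthWeight q t 0 := by
      have : E (F1 0) ≤ 1 := by
        rw [← prodExp_const (sum_triWeight hθ) (t + 1) 1]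
        exact prodExp_mono hK (triWeight_nonneg hθ) _ fun b _ => ind_le_one _
      exact mul_le_of_le_one_right (hdw 0) this
    have h1 : ∑ j ∈ range t, depthWeight q t (j + 1) * E (F1 (j + 1)) ≤
        ∑ j ∈ range t, (A * E (fun b => ind ((∀ k ≤ t, walk h b k ≤ walk h b (j + 1)) ∧
        ∀ k < j + 1, walk h b k < walk h b (j + 1))) + depthWeight q t (j + 1) * D) := by
      refine sum_le_sum fun j hj => ?_
      rw [mem_range] at hj
      refine (letter_raise hθ hj.le h (hdw _) (hA j hj) hA0).trans ?_
      have := mul_le_mul_of_nonneg_left (hD j hj.le) (hdw (j + 1))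
      linarith
    rw [sum_add_distrib, ← mul_sum, ← sum_mul] at h1
    have h2 := hEle (range t) (fun j b => (∀ k ≤ t, walk h b k ≤ walk h b (j + 1)) ∧
        ∀ k < j + 1, walk h b k < walk h b (j + 1)) (by
      rintro b i hi j hj ⟨hi1, hi2⟩ ⟨hj1, hj2⟩
      rw [mem_range] at hi hj
      by_contra hne
      rcases lt_or_gt_of_ne hne with hlt | hlt
      · have := hj2 (i + 1) (by omega)
        have := hi1 (j + 1) (by omega)
        omega
      · have := hi2 (j + 1) (by omega)
        have := hj1 (i + 1) (by omega)
        omega)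
    have h3 : ∑ j ∈ range t, depthWeight q t (j + 1) ≤ 1 := by
      have := sum_depthWeight hq0 hq1 t
      rw [sum_range_succ'] at this
      linarith [hdw 0]
    have h4 := mul_le_mul_of_nonneg_left h2 hA0
    have h5 := mul_le_mul_of_nonneg_right h3 hD0
    linarith
  have e2 : ∑ i ∈ range (t + 1), (∑ G ∈ range (i + 1), depthWeight q t G) * E (F2 i) ≤
      B + 2 * D := by
    have h1 : ∑ i ∈ range (t + 1), (∑ G ∈ range (i + 1), depthWeight q t G) * E (F2 i) ≤
        ∑ i ∈ range (t + 1), ((B + D) * E (fun b => ind ((∀ k ≤ t, walk h b k ≤ walk h b i) ∧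
        ∀ k ≤ t, i < k → walk h b k < walk h b i)) +
        D * E (fun b => ind ((∀ k ≤ t, walk h b k ≤ walk h b i + 1) ∧
        ∃ m ≤ t, ∀ k ≤ t, i < k → walk h b k + 1 < walk h b m))) := by
      refine sum_le_sum fun i hi => ?_
      rw [mem_range] at hi
      have hc : ∑ G ∈ range (i + 1), depthWeight q t G ≤ 1 := by
        rw [← sum_depthWeight hq0 hq1 t]
        exact sum_le_sum_of_subset_of_nonneg (range_mono (by omega)) fun G _ _ => hdw G
      refine letter_lower hθ (by omega) h (sum_nonneg fun G _ => hdw G) ?_ ?_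
      · rw [sum_depthWeight_range]
        exact hB i (by omega)
      · exact (mul_le_of_le_one_left (sq_nonneg _) hc).trans (hD i (by omega))
    rw [sum_add_distrib, ← mul_sum, ← mul_sum] at h1
    have h2 := hEle (range (t + 1)) (fun i b => (∀ k ≤ t, walk h b k ≤ walk h b i) ∧
        ∀ k ≤ t, i < k → walk h b k < walk h b i) (by
      rintro b i hi j hj ⟨hi1, hi2⟩ ⟨hj1, hj2⟩
      rw [mem_range] at hi hj
      by_contra hne
      rcases lt_or_gt_of_ne hne with hlt | hlt
      · have := hi2 j (by omega) hlt
        have := hj1 i (by omega)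
        omega
      · have := hj2 i (by omega) hlt
        have := hi1 j (by omega)
        omega)
    have h3 := hEle (range (t + 1)) (fun i b => (∀ k ≤ t, walk h b k ≤ walk h b i + 1) ∧
        ∃ m ≤ t, ∀ k ≤ t, i < k → walk h b k + 1 < walk h b m) (by
      rintro b i hi j hj ⟨hi1, m, hm, hi2⟩ ⟨hj1, m', hm', hj2⟩
      rw [mem_range] at hi hj
      by_contra hne
      rcases lt_or_gt_of_ne hne with hlt | hlt
      · have := hi2 j (by omega) hlt
        have := hj1 m (by omega)
        omega
      · have := hj2 i (by omega) hlt
        have := hi1 m' (by omega)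
        omega)
    have h4 := mul_le_mul_of_nonneg_left h2 (add_nonneg hB0 hD0)
    have h5 := mul_le_mul_of_nonneg_left h3 hD0
    linarith
  linarith

end tri
theorem sum_inv_sqrt_le (n : ℕ) :
    ∑ t ∈ range n, 1 / Real.sqrt (t + 1) ≤ 2 * Real.sqrt n := by
  induction n with
  | zero => simp
  | succ n ih =>
    rw [sum_range_succ]
    have h1 : 0 < Real.sqrt (n + 1) := Real.sqrt_pos.2 (by positivity)
    have h2 : Real.sqrt (n + 1) ^ 2 = n + 1 := Real.sq_sqrt (by positivity)
    have h3 : Real.sqrt n ^ 2 = n := Real.sq_sqrt (by positivity)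
    have h4 := Real.sqrt_nonneg (n : ℝ)
    have h5 : 1 / Real.sqrt (n + 1) ≤ 2 * (Real.sqrt (n + 1) - Real.sqrt n) := by
      rw [div_le_iff₀ h1]
      nlinarith [sq_nonneg (Real.sqrt (n + 1) - Real.sqrt n)]
    push_cast
    linarith

theorem sum_ind_lt_le (n : ℕ) {x : ℝ} (hx : 0 ≤ x) :
    ∑ t ∈ range n, ind (((t : ℝ) + 1) < x) ≤ x := by
  classical
  have h1 : ∑ t ∈ range n, ind (((t : ℝ) + 1) < x) ≤ ∑ t ∈ range ⌊x⌋₊, (1 : ℝ) := by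
    unfold ind
    rw [← sum_filter]
    refine sum_le_sum_of_subset_of_nonneg ?_ fun _ _ _ => zero_le_one
    intro t ht
    rw [mem_filter] at ht
    rw [mem_range]
    have : ((t + 1 : ℕ) : ℝ) ≤ x := by push_cast; exact ht.2.le
    have := Nat.le_floor this
    omega
  refine h1.trans ?_
  simpa using Nat.floor_le hx

theorem one_sub_mul_pow_le {q : ℝ} (hq0 : 0 < q) (hq1 : q < 1) (t : ℕ) :
    ((t : ℝ) + 1) * ((1 - q) * q ^ (t + 1)) ≤ 1 - q ^ (t + 1) := by
  have h1 : ∑ i ∈ range (t + 1), q ^ (t + 1) ≤ ∑ i ∈ range (t + 1), q ^ i :=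
    sum_le_sum fun i hi => pow_le_pow_of_le_one hq0.le hq1.le (mem_range.1 hi).le
  rw [sum_const, card_range, nsmul_eq_mul] at h1
  push_cast at h1
  have h2 := mul_le_mul_of_nonneg_left h1 (sub_pos.2 hq1).le
  rw [mul_comm (1 - q) (∑ i ∈ range (t + 1), q ^ i), geom_sum_mul_neg] at h2
  linarith

/-- Densities used in the potential at time `t`. -/
noncomputable def density (a q ε : ℝ) (t i : ℕ) : ℝ :=
  a / (2 * max (1 - q ^ (i + 1)) ε) + 1 / (4 * Real.sqrt (t + 1))

section
variable {q a ε : ℝ} (hq0 : 0 < q) (hq1 : q < 1) (ha : 0 < a) (haq : a ^ 2 = 1 - q)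
  (hε : 0 < ε) (hε1 : ε ≤ 1 / 4)
include hq0 hq1 ha haq hε hε1

omit hq0 hq1 haq hε1 in
theorem density_pos (t i : ℕ) : 0 < density a q ε t i := by
  have : 0 < max (1 - q ^ (i + 1)) ε := lt_max_of_lt_right hε
  have h1 : 0 < Real.sqrt ((t : ℝ) + 1) := Real.sqrt_pos.2 (by positivity)
  unfold density
  positivity

omit hq0 hq1 haq hε1 in
theorem density_le (t i : ℕ) : density a q ε t i ≤ a / (2 * ε) + 1 / (4 * Real.sqrt (t + 1)) := by
  unfold density
  gcongr
  exact le_max_right _ _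

theorem trans_potential_density_le (t : ℕ) {h : ℕ → ℕ} (hh : IsProfile h) :
    trans q t (potential (density a q ε t) (t + 1)) h ≤ potential (density a q ε t) t h +
      ((1 + ε) * a + (1 + 2 / ε ^ 2) * a ^ 2 + 6 * (1 / Real.sqrt (t + 1)) +
        (2 + 1 / (2 * ε)) * a * ind (((t : ℝ) + 1) < 1 / (ε * a ^ 2))) := by
  have hs : 0 < Real.sqrt ((t : ℝ) + 1) := Real.sqrt_pos.2 (by positivity)
  have hs2 : Real.sqrt ((t : ℝ) + 1) ^ 2 = t + 1 := Real.sq_sqrt (by positivity)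
  set u := 1 / Real.sqrt ((t : ℝ) + 1) with hu
  have hu0 : 0 < u := by positivity
  have hu1 : u ≤ 1 := by
    rw [hu, div_le_one hs, Real.one_le_sqrt]
    linarith [Nat.cast_nonneg (α := ℝ) t]
  have hu2 : u ^ 2 * (t + 1) = 1 := by
    rw [hu, div_pow, hs2]; field_simp
  have hut : 1 / (4 * Real.sqrt ((t : ℝ) + 1)) = u / 4 := by rw [hu]; field_simp
  have hθ := density_pos (q := q) ha hε t
  have hθle := density_le (q := q) ha hε t
  simp only [hut] at hθle
  have hpos := one_sub_pow_pos hq0 hq1 t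
  set r := 1 / (1 - q ^ (t + 1)) with hr
  have hr0 : 0 < r := by positivity
  have hr1 : a ^ 2 * r ≤ a ^ 2 + u ^ 2 := by
    have h1 := one_sub_mul_pow_le hq0 hq1 t
    have h2 : r * (1 - q ^ (t + 1)) = 1 := by rw [hr]; field_simp
    have h3 : r * (((t : ℝ) + 1) * ((1 - q) * q ^ (t + 1))) ≤ 1 :=
      (mul_le_mul_of_nonneg_left h1 hr0.le).trans h2.le
    rw [← haq] at h3
    have h4 : u ^ 2 * (r * (((t : ℝ) + 1) * (a ^ 2 * q ^ (t + 1)))) ≤ u ^ 2 * 1 := by gcongr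
    have h5 : u ^ 2 * (r * (((t : ℝ) + 1) * (a ^ 2 * q ^ (t + 1)))) =
        (u ^ 2 * (t + 1)) * (a ^ 2 * (r * q ^ (t + 1))) := by ring
    rw [h5, hu2] at h4
    nlinarith
  have hw : ∀ g, depthWeight q t g = a ^ 2 * r * q ^ g := by
    intro g
    rw [depthWeight, hr, haq]; ring
  have hpow : ∀ g, 0 < q ^ g ∧ q ^ g ≤ 1 := fun g => ⟨by positivity, pow_le_one₀ hq0.le hq1.le⟩
  have hci : ∀ i ≤ t, (1 - q ^ (i + 1)) * r ≤ 1 := by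
    intro i hi
    rw [hr, mul_one_div, div_le_one hpos]
    have := pow_le_pow_of_le_one hq0.le hq1.le (show i + 1 ≤ t + 1 by omega)
    linarith
  have hw0 : depthWeight q t 0 ≤ a ^ 2 + u ^ 2 := by rw [hw, pow_zero, mul_one]; exact hr1
  set D := (a / (2 * ε) + u / 4) ^ 2 with hD
  have hDi : ∀ i ≤ t, density a q ε t i ^ 2 ≤ D := fun i _ => by
    have := (hθ i).le
    exact pow_le_pow_left₀ this (hθle i) 2
  have hD4 : 4 * D ≤ 2 / ε ^ 2 * a ^ 2 + u ^ 2 / 2 := by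
    have h1 : 2 / ε ^ 2 * a ^ 2 = 8 * (a / (2 * ε)) ^ 2 := by field_simp; norm_num
    rw [h1, hD]
    nlinarith [sq_nonneg (a / (2 * ε) - u / 4)]
  have huu : u ^ 2 ≤ u := by nlinarith
  by_cases hlate : ((t : ℝ) + 1) < 1 / (ε * a ^ 2)
  · rw [ind_of hlate]
    have := trans_potential_le hθ hq0 hq1 (t := t) (A := 2 * a + 4 * u) (B := a / (2 * ε) + u / 4)
      (D := D) (by positivity) (fun j _ => ?_) (fun i hi => ?_) hDi hh
    · have h1 : (2 + 1 / (2 * ε)) * a = 2 * a + a / (2 * ε) := by ring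
      have : 0 < (1 + ε) * a := by positivity
      rw [mul_one, h1]
      linarith
    · rw [hw]
      have h1 : a / 2 + u / 4 ≤ density a q ε t j := by
        unfold density
        rw [hut]
        have h2 : 0 < max (1 - q ^ (j + 1)) ε := lt_max_of_lt_right hε
        have h3 : max (1 - q ^ (j + 1)) ε ≤ 1 := max_le (by linarith [hpow (j + 1)]) (by linarith)
        have : a / 2 ≤ a / (2 * max (1 - q ^ (j + 1)) ε) := by
          gcongr; linarith
        linarith
      calc a ^ 2 * r * q ^ (j + 1) ≤ a ^ 2 * r * 1 := by
            gcongr; exact (hpow _).2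
        _ ≤ a ^ 2 + u ^ 2 := by rw [mul_one]; exact hr1
        _ ≤ (2 * a + 4 * u) * (a / 2 + u / 4) := by nlinarith [mul_pos ha hu0]
        _ ≤ _ := by gcongr
    · rw [← mul_one_div, ← hr]
      calc (1 - q ^ (i + 1)) * r * density a q ε t i ≤ 1 * density a q ε t i := by
            have := (hθ i).le
            gcongr; exact hci i hi
        _ ≤ _ := by rw [one_mul]; exact hθle i
  · rw [ind_of_not hlate]
    rw [not_lt, div_le_iff₀ (by positivity)] at hlate
    have hrε : r ≤ 1 + ε := by
      have h1 : u ^ 2 * 1 ≤ u ^ 2 * (((t : ℝ) + 1) * (ε * a ^ 2)) := by gcongr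
      rw [← mul_assoc, hu2, one_mul, mul_one] at h1
      have h2 : a ^ 2 * r ≤ a ^ 2 * (1 + ε) := by linarith
      exact le_of_mul_le_mul_left h2 (by positivity)
    have := trans_potential_le hθ hq0 hq1 (t := t) (A := (1 + ε) * a / 2)
      (B := (1 + ε) * a / 2 + u / 4)
      (D := D) (by positivity) (fun j _ => ?_) (fun i hi => ?_) hDi hh
    · rw [mul_zero]
      linarith
    · rw [hw]
      have hm : 0 < max (1 - q ^ (j + 1)) ε := lt_max_of_lt_right hε
      have hx := hpow (j + 1)
      have h4 : q ^ (j + 1) * (4 * max (1 - q ^ (j + 1)) ε) ≤ 1 := by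
        rcases max_choice (1 - q ^ (j + 1)) ε with h | h <;> rw [h]
        · nlinarith [sq_nonneg (2 * q ^ (j + 1) - 1)]
        · nlinarith
      have h5 : q ^ (j + 1) ≤ 1 / (4 * max (1 - q ^ (j + 1)) ε) := by
        rw [le_div_iff₀ (by positivity)]; exact h4
      have h6 : a / (2 * max (1 - q ^ (j + 1)) ε) ≤ density a q ε t j := by
        unfold density
        rw [hut]; linarith
      calc a ^ 2 * r * q ^ (j + 1) ≤ a ^ 2 * (1 + ε) * (1 / (4 * max (1 - q ^ (j + 1)) ε)) := by
            gcongr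
        _ = (1 + ε) * a / 2 * (a / (2 * max (1 - q ^ (j + 1)) ε)) := by field_simp; norm_num
        _ ≤ _ := by gcongr
    · rw [← mul_one_div, ← hr]
      have hm : 0 < max (1 - q ^ (i + 1)) ε := lt_max_of_lt_right hε
      have hx := hpow (i + 1)
      have h1 : (1 - q ^ (i + 1)) * (a / (2 * max (1 - q ^ (i + 1)) ε)) ≤ a / 2 := by
        calc _ ≤ max (1 - q ^ (i + 1)) ε * (a / (2 * max (1 - q ^ (i + 1)) ε)) := by
              gcongr; exact le_max_left _ _
          _ = a / 2 := by field_simp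
      have h2 := mul_le_mul_of_nonneg_left h1 hr0.le
      have h3 : r * (a / 2) ≤ (1 + ε) * (a / 2) := by gcongr
      have h4 := mul_le_mul_of_nonneg_right (hci i hi) (show 0 ≤ u / 4 by positivity)
      unfold density
      rw [hut]
      linarith

/-- Upper bound on the mean of the longest increasing subsequence. -/
theorem chainExp_eval_zero_le (n : ℕ) : chainExp q n (fun h => (h 0 : ℝ)) ≤
    n * ((1 + ε) * a + (1 + 2 / ε ^ 2) * a ^ 2) + 12 * Real.sqrt n +
      (2 + 1 / (2 * ε)) * (1 / (ε * a)) := by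
  set f : ℕ → ℝ := fun t => (1 + ε) * a + (1 + 2 / ε ^ 2) * a ^ 2 + 6 * (1 / Real.sqrt (t + 1)) +
        (2 + 1 / (2 * ε)) * a * ind (((t : ℝ) + 1) < 1 / (ε * a ^ 2)) with hf
  have hθ := density_pos (q := q) ha hε
  have key : chainExp q n (potential (density a q ε n) n) ≤ ∑ t ∈ range n, f t := by
    induction n with
    | zero =>
      rw [chainExp_zero]
      simp [potential, prodExp_zero, walkMax, walk]
    | succ n ih =>
      rw [sum_range_succ, chainExp_succ]
      calc chainExp q n (trans q n (potential (density a q ε (n + 1)) (n + 1)))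
          ≤ chainExp q n (fun h => potential (density a q ε n) n h + f n) := by
            refine chainExp_mono hq0 hq1 n fun h hh => ?_
            refine le_trans ?_ (trans_potential_density_le hq0 hq1 ha haq hε hε1 n hh)
            refine trans_le_trans hq0 hq1 (fun h _ => ?_) n h hh
            refine potential_le_of_le (hθ _) (fun i => ?_) _ h
            unfold density
            have : 0 < Real.sqrt ((n : ℝ) + 1) := Real.sqrt_pos.2 (by positivity)
            gcongr
            linarith
        _ = chainExp q n (potential (density a q ε n) n) + f n :=
            chainExp_add_const hq0 hq1 n _ _
        _ ≤ _ := by linarith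
  have h1 : chainExp q n (fun h => (h 0 : ℝ)) ≤ chainExp q n (potential (density a q ε n) n) :=
    chainExp_mono hq0 hq1 n fun h _ => le_potential (hθ n) n h
  refine (h1.trans key).trans ?_
  simp only [hf, sum_add_distrib, sum_const, card_range, nsmul_eq_mul, ← mul_sum]
  have h2 := sum_inv_sqrt_le n
  have h3 := mul_le_mul_of_nonneg_left (sum_ind_lt_le n (x := 1 / (ε * a ^ 2)) (by positivity))
    (show 0 ≤ (2 + 1 / (2 * ε)) * a by positivity)
  have h4 : (2 + 1 / (2 * ε)) * a * (1 / (ε * a ^ 2)) = (2 + 1 / (2 * ε)) * (1 / (ε * a)) := by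
    field_simp
  rw [h4] at h3
  linarith
end
/-- Lower bound for the effect of one step on a window of the profile. -/
def bump (i : ℕ) (h : ℕ → ℕ) (j : ℕ) : ℕ := if j ≤ i then max (h j) (h (i + 1) + 1) else h j

theorem le_bump (i : ℕ) (h : ℕ → ℕ) : h ≤ bump i h := by
  intro j
  unfold bump
  split_ifs
  · exact le_max_left _ _
  · exact le_rfl

theorem bump_le {h : ℕ → ℕ} (hh : Antitone h) (i : ℕ) : bump i h ≤ h + 1 := by
  intro j
  unfold bump
  simp only [Pi.add_apply, Pi.one_apply]
  split_ifs with hj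
  · have := hh (show j ≤ i + 1 by omega)
    omega
  · omega

theorem bump_antitone {h : ℕ → ℕ} (hh : Antitone h) (i : ℕ) : Antitone (bump i h) := by
  intro j k hjk
  have h1 := hh hjk
  unfold bump
  split_ifs with hk hj
  · omega
  · omega
  · exact h1.trans (le_max_left _ _)
  · exact h1

theorem bump_mono (i : ℕ) : Monotone (bump i) := by
  intro a b hab j
  have h1 := hab j
  have h2 := hab (i + 1)
  unfold bump
  split_ifs
  · exact max_le_max h1 (Nat.add_le_add_right h2 1)
  · exact h1

theorem bump_add_one (i : ℕ) (h : ℕ → ℕ) : bump i (h + 1) = bump i h + 1 := by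
  ext j
  simp only [bump, Pi.add_apply, Pi.one_apply]
  split_ifs
  · exact (Nat.add_max_add_right _ _ 1)
  · rfl

/-- One row of the block model: column `i < m` is bumped with probability `p`. -/
noncomputable def rowOp (m : ℕ) (p : ℝ) : Module.End ℝ ((ℕ → ℕ) → ℝ) :=
  (1 - m * p) • 1 + p • ∑ i ∈ range m, LinearMap.funLeft ℝ ℝ (bump i)

theorem rowOp_apply (m : ℕ) (p : ℝ) (F : (ℕ → ℕ) → ℝ) (h : ℕ → ℕ) :
    rowOp m p F h = (1 - m * p) * F h + p * ∑ i ∈ range m, F (bump i h) := by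
  simp [rowOp, LinearMap.sum_apply, Finset.sum_apply, LinearMap.funLeft]

theorem rowOp_const (m : ℕ) (p c : ℝ) : rowOp m p (fun _ => c) = fun _ => c := by
  ext h
  rw [rowOp_apply, sum_const, card_range, nsmul_eq_mul]
  ring

theorem rowOp_pow_const (m : ℕ) (p c : ℝ) (t : ℕ) :
    (rowOp m p ^ t) (fun _ => c) = fun _ => c := by
  induction t with
  | zero => rfl
  | succ t ih => rw [pow_succ, Module.End.mul_apply, rowOp_const, ih]

theorem rowOp_pow_succ (m : ℕ) (p : ℝ) (t : ℕ) (F : (ℕ → ℕ) → ℝ) :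
    (rowOp m p ^ (t + 1)) F = (rowOp m p ^ t) (rowOp m p F) := by
  rw [pow_succ, Module.End.mul_apply]

theorem rowOp_pow_succ' (m : ℕ) (p : ℝ) (t : ℕ) (F : (ℕ → ℕ) → ℝ) :
    (rowOp m p ^ (t + 1)) F = rowOp m p ((rowOp m p ^ t) F) := by
  rw [pow_succ', Module.End.mul_apply]

section rows
variable {m : ℕ} {p : ℝ} (hp : 0 ≤ p) (hmp : m * p ≤ 1)
include hp hmp

theorem rowOp_le {F G : (ℕ → ℕ) → ℝ} (hFG : ∀ h, Antitone h → F h ≤ G h) (h : ℕ → ℕ)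
    (hh : Antitone h) : rowOp m p F h ≤ rowOp m p G h := by
  rw [rowOp_apply, rowOp_apply]
  have h0 : 0 ≤ 1 - m * p := by linarith
  have h1 := hFG h hh
  have h2 : ∑ i ∈ range m, F (bump i h) ≤ ∑ i ∈ range m, G (bump i h) :=
    sum_le_sum fun i _ => hFG _ (bump_antitone hh i)
  gcongr

theorem rowOp_pow_le {F G : (ℕ → ℕ) → ℝ} (hFG : ∀ h, Antitone h → F h ≤ G h) (t : ℕ) (h : ℕ → ℕ)
    (hh : Antitone h) : (rowOp m p ^ t) F h ≤ (rowOp m p ^ t) G h := by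
  induction t generalizing F G with
  | zero => exact hFG h hh
  | succ t ih =>
    rw [rowOp_pow_succ, rowOp_pow_succ]
    exact ih fun h hh => rowOp_le hp hmp hFG h hh

theorem Equivariant.rowOp {F : (ℕ → ℕ) → ℝ} (hF : Equivariant F) :
    Equivariant (rowOp m p F) where
  mono := fun a b hab => by
    rw [rowOp_apply, rowOp_apply]
    have h0 : 0 ≤ 1 - m * p := by linarith
    have h1 := hF.mono hab
    have h2 : ∑ i ∈ range m, F (bump i a) ≤ ∑ i ∈ range m, F (bump i b) :=
      sum_le_sum fun i _ => hF.mono (bump_mono i hab)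
    gcongr
  add_one := fun h => by
    rw [rowOp_apply, rowOp_apply]
    simp only [bump_add_one, hF.add_one, sum_add_distrib, sum_const, card_range, nsmul_eq_mul]
    ring

theorem Equivariant.rowOp_pow {F : (ℕ → ℕ) → ℝ} (hF : Equivariant F) (t : ℕ) :
    Equivariant ((MallowsLIS.rowOp m p ^ t) F) := by
  induction t with
  | zero => exact hF
  | succ t ih => rw [rowOp_pow_succ']; exact ih.rowOp hp hmp

omit hmp in
/-- The conditional variance of a single row is at most the mean increment. -/
theorem rowOp_sq_le {F : (ℕ → ℕ) → ℝ} (hF : Equivariant F) (h : ℕ → ℕ) (hh : Antitone h) :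
    rowOp m p (fun h => F h ^ 2) h ≤ rowOp m p F h ^ 2 + (rowOp m p F h - F h) := by
  set d : ℕ → ℝ := fun i => F (bump i h) - F h with hd
  have hd0 : ∀ i, 0 ≤ d i := fun i => sub_nonneg.2 (hF.mono (le_bump i h))
  have hd1 : ∀ i, d i ≤ 1 := fun i => by
    have := hF.mono (bump_le hh i)
    rw [hF.add_one] at this
    simp only [hd]; linarith
  have hFd : ∀ i, F (bump i h) = F h + d i := fun i => by simp [hd]
  have h2 : ∑ i ∈ range m, d i ^ 2 ≤ ∑ i ∈ range m, d i :=
    sum_le_sum fun i _ => by nlinarith [hd0 i, hd1 i]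
  rw [rowOp_apply, rowOp_apply]
  simp only [hFd, sum_add_distrib, sum_const, card_range, nsmul_eq_mul, add_sq, ← mul_sum]
  nlinarith [mul_le_mul_of_nonneg_left h2 hp, sq_nonneg (p * ∑ i ∈ range m, d i)]

theorem rowOp_pow_sub_le {F : (ℕ → ℕ) → ℝ} {β : ℝ}
    (hβ : ∀ h, Antitone h → rowOp m p F h ≤ F h + β) (t : ℕ) (h : ℕ → ℕ) (hh : Antitone h) :
    (rowOp m p ^ (t + 1)) F h ≤ (rowOp m p ^ t) F h + β := by
  have h1 := rowOp_pow_le hp hmp (G := F + fun _ => β) hβ t h hh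
  rw [map_add, rowOp_pow_const] at h1
  rw [rowOp_pow_succ]
  exact h1

theorem rowOp_pow_sq_le {F : (ℕ → ℕ) → ℝ} (hF : Equivariant F) {β : ℝ}
    (hβ : ∀ h, Antitone h → rowOp m p F h ≤ F h + β) (t : ℕ) (h : ℕ → ℕ) (hh : Antitone h) :
    (rowOp m p ^ t) (fun h => F h ^ 2) h ≤ (rowOp m p ^ t) F h ^ 2 + t * β := by
  induction t generalizing h with
  | zero => simp
  | succ t ih =>
    have h1 := rowOp_le hp hmp
      (G := (fun h => (rowOp m p ^ t) F h ^ 2) + fun _ => (t : ℝ) * β) (fun h hh => ih h hh) h hh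
    rw [map_add, rowOp_const] at h1
    have h2 := rowOp_sq_le (m := m) hp (hF.rowOp_pow hp hmp t) h hh
    have h3 := rowOp_pow_sub_le hp hmp hβ t h hh
    rw [rowOp_pow_succ', rowOp_pow_succ'] at *
    simp only [Pi.add_apply] at h1
    push_cast
    linarith
end rows

/-- Expectation over `N` independent bits that are `1` with probability `α`. -/
noncomputable def bitExp (α : ℝ) (N : ℕ) : ((ℕ → ℕ) → ℝ) →ₗ[ℝ] ℝ :=
  prodExp 2 (fun _ x => if x = 0 then 1 - α else α) N

theorem bitExp_zero (α : ℝ) (F : (ℕ → ℕ) → ℝ) : bitExp α 0 F = F 0 := rfl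

theorem bitExp_succ (α : ℝ) (N : ℕ) (F : (ℕ → ℕ) → ℝ) : bitExp α (N + 1) F =
    (1 - α) * bitExp α N (fun b => F (Function.update b N 0)) +
      α * bitExp α N (fun b => F (Function.update b N 1)) := by
  simp [bitExp, prodExp_succ, sum_range_succ]

theorem bitExp_const (α : ℝ) (N : ℕ) (c : ℝ) : bitExp α N (fun _ => c) = c :=
  prodExp_const (fun _ => by simp [sum_range_succ]) N c

section bits
variable {α : ℝ} (hα0 : 0 ≤ α) (hα1 : α ≤ 1)
include hα0 hα1

theorem bitExp_mono (N : ℕ) {F G : (ℕ → ℕ) → ℝ} (hFG : ∀ b, (∀ i, b i < 2) → F b ≤ G b) :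
    bitExp α N F ≤ bitExp α N G :=
  prodExp_mono (by norm_num) (fun _ x => by split_ifs <;> linarith) N hFG

theorem bitExp_le_of_letter (N : ℕ) {i : ℕ} (hi : i < N) {F G : (ℕ → ℕ) → ℝ}
    (hFG : ∀ b, (∀ i, b i < 2) →
      (1 - α) * F (Function.update b i 0) + α * F (Function.update b i 1) ≤
      (1 - α) * G (Function.update b i 0) + α * G (Function.update b i 1)) :
    bitExp α N F ≤ bitExp α N G :=
  prodExp_le_of_letter (by norm_num) (fun _ x => by split_ifs <;> linarith) N hi
    fun b hb => by simpa [sum_range_succ] using hFG b hb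

/-- Efron–Stein bound for functions that grow by at most one when a bit is switched on. -/
theorem bitExp_sq_le (N : ℕ) {F : (ℕ → ℕ) → ℝ}
    (h0 : ∀ b i, F (Function.update b i 0) ≤ F (Function.update b i 1))
    (h1 : ∀ b i, F (Function.update b i 1) ≤ F (Function.update b i 0) + 1) :
    bitExp α N (fun b => F b ^ 2) ≤ bitExp α N F ^ 2 + N * α := by
  induction N generalizing F with
  | zero => simp [bitExp_zero]
  | succ N ih =>
    have key : ∀ x, bitExp α N (fun b => F (Function.update b N x) ^ 2) ≤
        bitExp α N (fun b => F (Function.update b N x)) ^ 2 + N * α := by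
      intro x
      by_cases hN : N = 0
      · subst hN; simp [bitExp_zero]
      refine ih (F := fun b => F (Function.update b N x)) (fun b i => ?_) (fun b i => ?_)
      · by_cases hi : i = N
        · subst hi; simp
        · simpa only [Function.update_comm hi] using h0 _ i
      · by_cases hi : i = N
        · subst hi; simp
        · simpa only [Function.update_comm hi] using h1 _ i
    rw [bitExp_succ, bitExp_succ]
    have k0 := key 0
    have k1 := key 1
    set x := bitExp α N (fun b => F (Function.update b N 0))
    have hx : x ≤ bitExp α N (fun b => F (Function.update b N 1)) :=
      bitExp_mono hα0 hα1 N fun b _ => h0 b N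
    have hx1 : bitExp α N (fun b => F (Function.update b N 1)) ≤ x + 1 := by
      have := bitExp_mono hα0 hα1 N
        (G := (fun b => F (Function.update b N 0)) + fun _ => 1) fun b _ => h1 b N
      rwa [map_add, bitExp_const] at this
    set y := bitExp α N (fun b => F (Function.update b N 1))
    push_cast
    have e1 := mul_le_mul_of_nonneg_left k0 (sub_nonneg.2 hα1)
    have e2 := mul_le_mul_of_nonneg_left k1 hα0
    have e3 : (y - x) ^ 2 ≤ 1 := by nlinarith
    have e4 : α * (1 - α) * (y - x) ^ 2 ≤ α * 1 * 1 := by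
      gcongr
      linarith
    nlinarith
end bits

/-- The walk attains its maximum over `{0, …, m}` for the first time at `j`. -/
def FirstMax (h b : ℕ → ℕ) (m j : ℕ) : Prop :=
  ∀ k ≤ m, walk h b k ≤ walk h b j ∧ (k < j → walk h b k < walk h b j)

theorem walkMax_eq_iff {h b : ℕ → ℕ} {m j : ℕ} (hj : j ≤ m) :
    walkMax h b m = walk h b j ↔ ∀ k ≤ m, walk h b k ≤ walk h b j := by
  constructor
  · intro e k hk
    rw [← e]; exact walk_le_walkMax h b hk
  · intro H
    obtain ⟨k, hk, e⟩ := exists_walkMax h b m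
    exact le_antisymm (e ▸ H k hk) (walk_le_walkMax h b hj)

theorem walk_zero (h b : ℕ → ℕ) : walk h b 0 = h 0 := by simp [walk]

theorem walkMax_bump {h : ℕ → ℕ} (b : ℕ → ℕ) {m i : ℕ} (hi : i < m) :
    walkMax (bump i h) b m = max (walkMax h b m) (h (i + 1) + 1 + ∑ k ∈ range i, b k) := by
  apply le_antisymm
  · obtain ⟨j, hj, e⟩ := exists_walkMax (bump i h) b m
    rw [e]
    have h1 := walk_le_walkMax h b hj
    unfold walk at h1 ⊢
    unfold bump
    split_ifs with hji
    · have h2 : ∑ k ∈ range j, b k ≤ ∑ k ∈ range i, b k := sum_le_sum_of_subset (range_mono hji)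
      omega
    · omega
  · refine max_le (walkMax_mono (le_bump i h) le_rfl m) ?_
    refine le_trans ?_ (walk_le_walkMax _ _ hi.le)
    unfold walk bump
    rw [if_pos le_rfl]
    omega

theorem walkMax_bump_one {h b : ℕ → ℕ} {m i : ℕ} (hi : i < m) (hb : b i = 1) :
    walkMax (bump i h) b m = walkMax h b m := by
  rw [walkMax_bump b hi, max_eq_left]
  have := walk_le_walkMax h b (show i + 1 ≤ m from hi)
  unfold walk at this
  rw [sum_range_succ, hb] at this
  omega

theorem walkMax_bump_zero {h b : ℕ → ℕ} {m i : ℕ} (hi : i < m) (hb : b i = 0) :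
    (walkMax (bump i h) b m : ℝ) =
      walkMax h b m + ind (∀ k ≤ m, walk h b k ≤ walk h b (i + 1)) := by
  have hw : walk h b (i + 1) = h (i + 1) + ∑ k ∈ range i, b k := by
    unfold walk; rw [sum_range_succ, hb, add_zero]
  have h1 := walk_le_walkMax h b (show i + 1 ≤ m from hi)
  rw [walkMax_bump b hi]
  by_cases H : ∀ k ≤ m, walk h b k ≤ walk h b (i + 1)
  · rw [ind_of H]
    have e := (walkMax_eq_iff (show i + 1 ≤ m from hi)).2 H
    rw [max_eq_right (by omega)]
    have : h (i + 1) + 1 + ∑ k ∈ range i, b k = walkMax h b m + 1 := by omega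
    rw [this]; push_cast; ring
  · rw [ind_of_not H, add_zero]
    have e := mt (walkMax_eq_iff (show i + 1 ≤ m from hi)).1 H
    rw [max_eq_left (by omega)]

theorem not_firstMax_of_zero {h b : ℕ → ℕ} (hh : Antitone h) {m i : ℕ} (hi : i < m)
    (hb : b i = 0) : ¬FirstMax h b m (i + 1) := by
  intro H
  have h1 := (H i hi.le).2 (Nat.lt_succ_self i)
  have h2 := hh (Nat.le_succ i)
  unfold walk at h1
  rw [sum_range_succ, hb] at h1
  simp only [Nat.succ_eq_add_one] at h2
  omega

theorem firstMax_update_one (h b : ℕ → ℕ) (m i : ℕ) :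
    FirstMax h (Function.update b i 1) m (i + 1) ↔
      ∀ k ≤ m, walk h (Function.update b i 0) k ≤ walk h (Function.update b i 0) (i + 1) := by
  unfold FirstMax
  refine forall₂_congr fun k _ => ?_
  rw [walk_update h b i 1 k, walk_update h b i 1 (i + 1), if_pos (Nat.lt_succ_self i)]
  split_ifs with hk <;> omega

theorem exists_firstMax (h b : ℕ → ℕ) (m : ℕ) : ∃ j ≤ m, FirstMax h b m j := by
  have hex : ∃ j, j ≤ m ∧ walkMax h b m = walk h b j := exists_walkMax h b m
  classical
  refine ⟨Nat.find hex, (Nat.find_spec hex).1, fun k hk => ⟨?_, fun hlt => ?_⟩⟩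
  · rw [← (Nat.find_spec hex).2]; exact walk_le_walkMax h b hk
  · have h1 := Nat.find_min hex hlt
    have h2 := walk_le_walkMax h b hk
    rw [← (Nat.find_spec hex).2]
    push Not at h1
    have := h1 hk
    omega

theorem sum_firstMax_le_one (h b : ℕ → ℕ) (m : ℕ) :
    ∑ i ∈ range m, ind (FirstMax h b m (i + 1)) ≤ 1 := by
  refine sum_ind_le_one _ _ fun i hi j hj hPi hPj => ?_
  rw [mem_range] at hi hj
  have h1 := (hPi (j + 1) hj)
  have h2 := (hPj (i + 1) hi)
  by_contra hne
  rcases Nat.lt_or_gt_of_ne hne with h3 | h3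
  · have := h2.2 (by omega); omega
  · have := h1.2 (by omega); omega

theorem one_le_sum_firstMax (h b : ℕ → ℕ) (m : ℕ) :
    1 - ind (walkMax h b m = h 0) ≤ ∑ i ∈ range m, ind (FirstMax h b m (i + 1)) := by
  obtain ⟨j, hj, hF⟩ := exists_firstMax h b m
  cases j with
  | zero =>
    rw [ind_of (by rw [← walk_zero h b, walkMax_eq_iff (Nat.zero_le _)]; exact fun k hk =>
      (hF k hk).1), sub_self]
    exact sum_nonneg fun i _ => ind_nonneg _
  | succ i =>
    have h1 := single_le_sum (f := fun i => ind (FirstMax h b m (i + 1)))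
      (fun i _ => ind_nonneg _) (mem_range.2 (show i < m by omega))
    rw [ind_of hF] at h1
    linarith [ind_nonneg (walkMax h b m = h 0)]

/-- Mean of the maximum of the walk with random bits. -/
noncomputable def meanMax (α : ℝ) (m : ℕ) (h : ℕ → ℕ) : ℝ :=
  bitExp α m fun b => (walkMax h b m : ℝ)

theorem walkMax_add_one (h b : ℕ → ℕ) (m : ℕ) : walkMax (h + 1) b m = walkMax h b m + 1 := by
  have e : ∀ j, walk (h + 1) b j = walk h b j + 1 := fun j => by
    simp only [walk, Pi.add_apply, Pi.one_apply]; omega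
  apply le_antisymm
  · obtain ⟨j, hj, e1⟩ := exists_walkMax (h + 1) b m
    rw [e1, e]
    exact Nat.add_le_add_right (walk_le_walkMax h b hj) 1
  · obtain ⟨j, hj, e1⟩ := exists_walkMax h b m
    rw [e1, ← e]
    exact walk_le_walkMax _ b hj

theorem walkMax_update_le (h b : ℕ → ℕ) (i m : ℕ) :
    walkMax h (Function.update b i 1) m ≤ walkMax h (Function.update b i 0) m + 1 := by
  obtain ⟨j, hj, e⟩ := exists_walkMax h (Function.update b i 1) m
  rw [e, walk_update]
  have := walk_le_walkMax h (Function.update b i 0) hj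
  split_ifs <;> omega

theorem bitExp_sum (α : ℝ) (d : ℕ → ℝ) (N : ℕ) :
    bitExp α N (fun b => ∑ i ∈ range N, d i * b i) = α * ∑ i ∈ range N, d i := by
  induction N with
  | zero => simp [bitExp_zero]
  | succ N ih =>
    have e : ∀ x : ℕ, (fun b : ℕ → ℕ =>
        ∑ i ∈ range (N + 1), d i * (Function.update b N x i : ℝ)) =
        (fun b => ∑ i ∈ range N, d i * (b i : ℝ)) + fun _ => d N * x := by
      intro x; ext b
      rw [sum_range_succ, Pi.add_apply, Function.update_self]
      congr 1
      refine sum_congr rfl fun i hi => ?_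
      rw [Function.update_of_ne (by rw [mem_range] at hi; omega)]
    rw [bitExp_succ, e, e, map_add, map_add, bitExp_const, bitExp_const, ih, sum_range_succ]
    push_cast; ring

section
variable {α : ℝ} (hα0 : 0 < α) (hα1 : α ≤ 1)
include hα0 hα1

theorem equivariant_meanMax (m : ℕ) : Equivariant (meanMax α m) where
  mono := fun a b hab => bitExp_mono hα0.le hα1 m fun c _ => by
    exact_mod_cast walkMax_mono hab le_rfl m
  add_one := fun h => by
    have : (fun b => (walkMax (h + 1) b m : ℝ)) = (fun b => (walkMax h b m : ℝ)) + fun _ => 1 := by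
      ext b; simp [walkMax_add_one]
    rw [meanMax, this, map_add, bitExp_const]; rfl

omit hα0 hα1 in
theorem meanMax_zero (m : ℕ) : meanMax α m 0 = m * α := by
  have e : ∀ b, walkMax 0 b m = ∑ i ∈ range m, b i := by
    intro b
    have : walk 0 b m = ∑ i ∈ range m, b i := by simp [walk]
    rw [← this, walkMax_eq_iff le_rfl]
    intro k hk
    unfold walk
    exact Nat.add_le_add_left (sum_le_sum_of_subset (range_mono hk)) _
  have e2 : (fun b : ℕ → ℕ => (walkMax 0 b m : ℝ)) = fun b => ∑ i ∈ range m, 1 * (b i : ℝ) := by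
    ext b; rw [e]; simp
  rw [meanMax, e2, bitExp_sum]
  simp [mul_comm]

theorem bitExp_walkMax_bump {h : ℕ → ℕ} (hh : Antitone h) {m i : ℕ} (hi : i < m) :
    meanMax α m (bump i h) = meanMax α m h +
      (1 - α) / α * bitExp α m (fun b => ind (FirstMax h b m (i + 1))) := by
  have e : meanMax α m h + (1 - α) / α * bitExp α m (fun b => ind (FirstMax h b m (i + 1))) =
      bitExp α m ((fun b => (walkMax h b m : ℝ)) +
        ((1 - α) / α) • fun b => ind (FirstMax h b m (i + 1))) := by
    rw [map_add, map_smul]; rfl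
  have key : ∀ b : ℕ → ℕ,
      (1 - α) * (walkMax (bump i h) (Function.update b i 0) m : ℝ) +
        α * (walkMax (bump i h) (Function.update b i 1) m : ℝ) =
      (1 - α) * ((walkMax h (Function.update b i 0) m : ℝ) +
        (1 - α) / α * ind (FirstMax h (Function.update b i 0) m (i + 1))) +
      α * ((walkMax h (Function.update b i 1) m : ℝ) +
        (1 - α) / α * ind (FirstMax h (Function.update b i 1) m (i + 1))) := by
    intro b
    rw [walkMax_bump_one (b := Function.update b i 1) hi (by simp),
      walkMax_bump_zero (b := Function.update b i 0) hi (by simp),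
      ind_of_not (not_firstMax_of_zero hh hi (by simp)), firstMax_update_one]
    field_simp
    ring
  rw [e]
  exact le_antisymm (bitExp_le_of_letter hα0.le hα1 m hi fun b _ => (key b).le)
    (bitExp_le_of_letter hα0.le hα1 m hi fun b _ => (key b).ge)

theorem rowOp_meanMax (m : ℕ) (p : ℝ) {h : ℕ → ℕ} (hh : Antitone h) :
    rowOp m p (meanMax α m) h = meanMax α m h + p * ((1 - α) / α) *
      bitExp α m (fun b => ∑ i ∈ range m, ind (FirstMax h b m (i + 1))) := by
  have e : (fun b => ∑ i ∈ range m, ind (FirstMax h b m (i + 1))) =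
      ∑ i ∈ range m, fun b => ind (FirstMax h b m (i + 1)) := by ext b; simp
  rw [e, map_sum, rowOp_apply,
    sum_congr rfl fun i hi => bitExp_walkMax_bump hα0 hα1 hh (mem_range.1 hi),
    sum_add_distrib, sum_const, card_range, nsmul_eq_mul, ← mul_sum]
  ring

theorem rowOp_meanMax_le (m : ℕ) {p : ℝ} (hp : 0 ≤ p) {h : ℕ → ℕ} (hh : Antitone h) :
    rowOp m p (meanMax α m) h ≤ meanMax α m h + p * ((1 - α) / α) := by
  rw [rowOp_meanMax hα0 hα1 m p hh]
  have h1 := bitExp_mono hα0.le hα1 m (F := fun b => ∑ i ∈ range m, ind (FirstMax h b m (i + 1)))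
    (G := fun _ => 1) fun b _ => sum_firstMax_le_one h b m
  rw [bitExp_const] at h1
  have h2 : 0 ≤ p * ((1 - α) / α) := mul_nonneg hp (div_nonneg (by linarith) hα0.le)
  nlinarith

theorem le_rowOp_meanMax (m : ℕ) {p : ℝ} (hp : 0 ≤ p) {h : ℕ → ℕ} (hh : Antitone h) :
    meanMax α m h + p * ((1 - α) / α) *
      (1 - bitExp α m (fun b => ind (walkMax h b m = h 0))) ≤ rowOp m p (meanMax α m) h := by
  rw [rowOp_meanMax hα0 hα1 m p hh]
  have h1 := bitExp_mono hα0.le hα1 m (F := (fun _ => 1) - fun b => ind (walkMax h b m = h 0))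
    (G := fun b => ∑ i ∈ range m, ind (FirstMax h b m (i + 1)))
    fun b _ => one_le_sum_firstMax h b m
  rw [map_sub, bitExp_const] at h1
  have h2 : 0 ≤ p * ((1 - α) / α) := mul_nonneg hp (div_nonneg (by linarith) hα0.le)
  gcongr
end

/-- Thinning: a product of independent bits is a bit. -/
theorem bitExp_mul (θ α : ℝ) (N : ℕ) (F : (ℕ → ℕ) → ℝ) :
    bitExp (θ * α) N F = bitExp α N fun b => bitExp θ N fun c => F (b * c) := by
  induction N generalizing F with
  | zero => simp [bitExp_zero]
  | succ N ih =>
    have e : ∀ x : ℕ, (fun b : ℕ → ℕ => bitExp θ (N + 1) fun c => F (Function.update b N x * c)) =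
        (1 - θ) • (fun b => bitExp θ N fun c => F (Function.update (b * c) N 0)) +
          θ • fun b => bitExp θ N fun c => F (Function.update (b * c) N x) := by
      intro x; ext b
      rw [bitExp_succ]
      simp only [← Function.update_mul, mul_zero, mul_one]
      rfl
    rw [bitExp_succ, bitExp_succ, e, e]
    simp only [map_add, map_smul, smul_eq_mul]
    rw [ih, ih]
    ring

/-- Thinning a word keeps at most the corresponding part of the record steps of the walk. -/
theorem walkMax_mul_le {h b c : ℕ → ℕ} (hh : Antitone h) (hc : ∀ i, c i < 2) (m : ℕ) :
    (walkMax h (b * c) m : ℝ) ≤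
      h 0 + ∑ i ∈ range m, ((walkMax h b (i + 1) : ℝ) - walkMax h b i) * c i := by
  have hmono : ∀ i, walkMax h b i ≤ walkMax h b (i + 1) := fun i =>
    Finset.sup_mono (range_mono (by omega))
  have hstep : ∀ i, walkMax h b (i + 1) ≤ walkMax h b i + b i := by
    intro i
    obtain ⟨j, hj, e⟩ := exists_walkMax h b (i + 1)
    rw [e]
    rcases Nat.lt_or_eq_of_le hj with hlt | rfl
    · have := walk_le_walkMax h b (show j ≤ i by omega); omega
    · have h1 := walk_le_walkMax h b (le_refl i)
      have h2 := hh (Nat.le_succ i)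
      unfold walk at h1 ⊢
      rw [sum_range_succ]
      simp only [Nat.succ_eq_add_one] at h2
      omega
  have hd0 : ∀ i, (0 : ℝ) ≤ (walkMax h b (i + 1) : ℝ) - walkMax h b i := fun i =>
    sub_nonneg.2 (by exact_mod_cast hmono i)
  have hd1 : ∀ i, (walkMax h b (i + 1) : ℝ) - walkMax h b i ≤ b i := fun i => by
    have : (walkMax h b (i + 1) : ℝ) ≤ walkMax h b i + b i := by exact_mod_cast hstep i
    linarith
  obtain ⟨j, hj, e⟩ := exists_walkMax h (b * c) m
  rw [e]
  have h1 : (walk h b j : ℝ) ≤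
      h 0 + ∑ i ∈ range j, ((walkMax h b (i + 1) : ℝ) - walkMax h b i) := by
    rw [sum_range_sub (fun i => (walkMax h b i : ℝ))]
    have h2 : walkMax h b 0 = h 0 := by simp [walkMax, walk]
    have h3 : (walk h b j : ℝ) ≤ walkMax h b j := by exact_mod_cast walk_le_walkMax h b le_rfl
    rw [h2]; linarith
  have h2 : (walk h (b * c) j : ℝ) = walk h b j - ∑ i ∈ range j, (b i : ℝ) * (1 - c i) := by
    unfold walk
    push_cast [Pi.mul_apply]
    simp only [mul_sub, sum_sub_distrib, mul_one]
    ring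
  have h3 : ∑ i ∈ range j, ((walkMax h b (i + 1) : ℝ) - walkMax h b i) * (1 - c i) ≤
      ∑ i ∈ range j, (b i : ℝ) * (1 - c i) := by
    refine sum_le_sum fun i _ => mul_le_mul_of_nonneg_right (hd1 i) ?_
    have : (c i : ℝ) ≤ 1 := by exact_mod_cast Nat.lt_succ_iff.1 (hc i)
    linarith
  have h4 : ∑ i ∈ range j, ((walkMax h b (i + 1) : ℝ) - walkMax h b i) * c i ≤
      ∑ i ∈ range m, ((walkMax h b (i + 1) : ℝ) - walkMax h b i) * c i :=
    sum_le_sum_of_subset_of_nonneg (range_mono hj) fun i _ _ =>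
      mul_nonneg (hd0 i) (Nat.cast_nonneg _)
  simp only [mul_sub, mul_one, sum_sub_distrib] at h3
  simp only [sum_sub_distrib] at h1
  rw [h2]
  simp only [mul_sub, mul_one, sum_sub_distrib]
  linarith

theorem meanMax_mul_le {θ α : ℝ} (hθ0 : 0 ≤ θ) (hθ1 : θ ≤ 1) (hα0 : 0 ≤ α) (hα1 : α ≤ 1) (m : ℕ)
    {h : ℕ → ℕ} (hh : Antitone h) :
    meanMax (θ * α) m h ≤ (1 - θ) * h 0 + θ * meanMax α m h := by
  have h1 : ∀ b : ℕ → ℕ, bitExp θ m (fun c => (walkMax h (b * c) m : ℝ)) ≤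
      (1 - θ) * h 0 + θ * walkMax h b m := by
    intro b
    refine (bitExp_mono hθ0 hθ1 m (G := (fun _ => (h 0 : ℝ)) + fun c => ∑ i ∈ range m,
      ((walkMax h b (i + 1) : ℝ) - walkMax h b i) * c i)
      fun c hc => walkMax_mul_le hh hc m).trans ?_
    have h2 : walkMax h b 0 = h 0 := by simp [walkMax, walk]
    rw [map_add, bitExp_const, bitExp_sum, sum_range_sub (fun i => (walkMax h b i : ℝ)), h2]
    linarith
  unfold meanMax
  rw [bitExp_mul]
  refine (bitExp_mono hα0 hα1 m (G := (fun _ => (1 - θ) * (h 0 : ℝ)) +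
    θ • fun b => (walkMax h b m : ℝ)) fun b _ => h1 b).trans ?_
  rw [map_add, map_smul, bitExp_const, smul_eq_mul]

section
variable {m : ℕ} {p : ℝ} (hp : 0 ≤ p) (hmp : m * p ≤ 1)
include hp hmp

/-- Extrapolation to bit density zero. -/
theorem rowOp_pow_meanMax_mul_le {θ α : ℝ} (hθ0 : 0 ≤ θ) (hθ1 : θ ≤ 1) (hα0 : 0 ≤ α) (hα1 : α ≤ 1)
    (s : ℕ) : (rowOp m p ^ s) (meanMax (θ * α) m) 0 ≤
      (1 - θ) * (rowOp m p ^ s) (fun h => (h 0 : ℝ)) 0 +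
        θ * (rowOp m p ^ s) (meanMax α m) 0 := by
  have h1 := rowOp_pow_le hp hmp (F := meanMax (θ * α) m)
    (G := (1 - θ) • (fun h : ℕ → ℕ => (h 0 : ℝ)) + θ • meanMax α m)
    (fun h hh => meanMax_mul_le hθ0 hθ1 hα0 hα1 m hh) s 0 antitone_const
  rwa [map_add, map_smul, map_smul] at h1

variable {α : ℝ} (hα0 : 0 < α) (hα1 : α ≤ 1)
include hα0 hα1

theorem rowOp_pow_meanMax_le (t : ℕ) :
    (rowOp m p ^ t) (meanMax α m) 0 ≤ m * α + t * (p * ((1 - α) / α)) := by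
  induction t with
  | zero => simp [meanMax_zero]
  | succ t ih =>
    have := rowOp_pow_sub_le hp hmp (fun h hh => rowOp_meanMax_le hα0 hα1 m hp hh) t 0
      antitone_const
    push_cast
    linarith

theorem le_rowOp_pow_meanMax {κ : ℝ} (t : ℕ)
    (hκ : ∀ u < t, (rowOp m p ^ u) (fun h => bitExp α m fun b => ind (walkMax h b m = h 0)) 0 ≤ κ) :
    m * α + t * (p * ((1 - α) / α)) * (1 - κ) ≤ (rowOp m p ^ t) (meanMax α m) 0 := by
  induction t with
  | zero => simp [meanMax_zero]
  | succ t ih =>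
    have h1 := rowOp_pow_le hp hmp (F := meanMax α m + (p * ((1 - α) / α)) •
      ((fun _ => 1) - fun h => bitExp α m fun b => ind (walkMax h b m = h 0)))
      (fun h hh => le_rowOp_meanMax hα0 hα1 m hp hh) t 0 antitone_const
    rw [map_add, map_smul, map_sub, rowOp_pow_const, ← rowOp_pow_succ] at h1
    simp only [Pi.add_apply, Pi.smul_apply, Pi.sub_apply, smul_eq_mul] at h1
    have h2 := hκ t (Nat.lt_succ_self t)
    have h3 := ih fun u hu => hκ u (by omega)
    have h4 : 0 ≤ p * ((1 - α) / α) := mul_nonneg hp (div_nonneg (by linarith) hα0.le)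
    push_cast
    nlinarith

theorem rowOp_pow_variance_le (t : ℕ) :
    (rowOp m p ^ t) (fun h => bitExp α m fun b =>
      ((walkMax h b m : ℝ) - (rowOp m p ^ t) (meanMax α m) 0) ^ 2) 0 ≤
      m * α + t * (p * ((1 - α) / α)) := by
  set c := (rowOp m p ^ t) (meanMax α m) 0 with hc
  have e : (fun h => bitExp α m fun b => ((walkMax h b m : ℝ) - c) ^ 2) =
      (fun h => bitExp α m fun b => (walkMax h b m : ℝ) ^ 2) +
        (-(2 * c)) • meanMax α m + fun _ => c ^ 2 := by
    ext h
    have : (fun b => ((walkMax h b m : ℝ) - c) ^ 2) = (fun b => (walkMax h b m : ℝ) ^ 2) +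
        (-(2 * c)) • (fun b => (walkMax h b m : ℝ)) + fun _ => c ^ 2 := by
      ext b; simp only [Pi.add_apply, Pi.smul_apply, smul_eq_mul]; ring
    rw [this, map_add, map_add, map_smul, bitExp_const]
    rfl
  have h1 := rowOp_pow_le hp hmp (F := fun h => bitExp α m fun b => (walkMax h b m : ℝ) ^ 2)
    (G := (fun h => meanMax α m h ^ 2) + fun _ => (m : ℝ) * α) (fun h hh => by
      refine bitExp_sq_le hα0.le hα1 m (F := fun b => (walkMax h b m : ℝ))
        (fun b i => ?_) fun b i => ?_
      · exact_mod_cast walkMax_mono le_rfl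
          (update_le_update_iff.2 ⟨Nat.zero_le 1, fun j _ => le_rfl⟩) m
      · exact_mod_cast walkMax_update_le h b i m) t 0 antitone_const
  have h2 := rowOp_pow_sq_le hp hmp (equivariant_meanMax hα0 hα1 m)
    (fun h hh => rowOp_meanMax_le hα0 hα1 m hp hh) t 0 antitone_const
  rw [e, map_add, map_add, map_smul, rowOp_pow_const]
  rw [map_add, rowOp_pow_const] at h1
  simp only [Pi.add_apply, Pi.smul_apply, smul_eq_mul] at h1 ⊢
  rw [← hc] at h2 ⊢
  nlinarith

/-- Chebyshev comparison of two bit densities. -/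
theorem rowOp_pow_ind_le {α' : ℝ} (hα0' : 0 < α') (hα1' : α' ≤ 1) (t : ℕ) {g : ℝ} (hg : 0 < g)
    (hgap : (rowOp m p ^ t) (meanMax α' m) 0 + 2 * g ≤ (rowOp m p ^ t) (meanMax α m) 0) :
    (rowOp m p ^ t) (fun h => bitExp α m fun b => ind (walkMax h b m = h 0)) 0 ≤
      (g ^ 2)⁻¹ * (m * α + t * (p * ((1 - α) / α)) + (m * α' + t * (p * ((1 - α') / α')))) := by
  have v1 := rowOp_pow_variance_le hp hmp hα0 hα1 t
  have v2 := rowOp_pow_variance_le hp hmp hα0' hα1' t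
  set μ := (rowOp m p ^ t) (meanMax α m) 0
  set ν := (rowOp m p ^ t) (meanMax α' m) 0
  have hg2 : 0 < (g ^ 2)⁻¹ := by positivity
  have sq : ∀ y : ℝ, g ≤ |y| → 1 ≤ (g ^ 2)⁻¹ * y ^ 2 := by
    intro y hy
    rw [inv_mul_eq_div, one_le_div (by positivity), ← sq_abs y]
    gcongr
  have h1 := rowOp_pow_le hp hmp
    (F := fun h => bitExp α m fun b => ind (walkMax h b m = h 0))
    (G := (g ^ 2)⁻¹ • ((fun h => bitExp α m fun b => ((walkMax h b m : ℝ) - μ) ^ 2) +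
      fun h => bitExp α' m fun b => ((walkMax h b m : ℝ) - ν) ^ 2)) (fun h hh => by
    simp only [Pi.add_apply, Pi.smul_apply, smul_eq_mul, mul_add]
    rw [← smul_eq_mul, ← smul_eq_mul, ← map_smul, ← map_smul]
    have n1 : 0 ≤ bitExp α m ((g ^ 2)⁻¹ • fun b => ((walkMax h b m : ℝ) - μ) ^ 2) := by
      rw [← bitExp_const α m 0]
      exact bitExp_mono hα0.le hα1 m fun b _ => mul_nonneg hg2.le (sq_nonneg _)
    have n2 : 0 ≤ bitExp α' m ((g ^ 2)⁻¹ • fun b => ((walkMax h b m : ℝ) - ν) ^ 2) := by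
      rw [← bitExp_const α' m 0]
      exact bitExp_mono hα0'.le hα1' m fun b _ => mul_nonneg hg2.le (sq_nonneg _)
    rcases le_total (ν + g) (h 0 : ℝ) with hx | hx
    · have a1 : bitExp α m (fun b => ind (walkMax h b m = h 0)) ≤ 1 := by
        rw [← bitExp_const α m 1]
        exact bitExp_mono hα0.le hα1 m fun b _ => ind_le_one _
      have a2 : 1 ≤ bitExp α' m ((g ^ 2)⁻¹ • fun b => ((walkMax h b m : ℝ) - ν) ^ 2) := by
        rw [← bitExp_const α' m 1]
        refine bitExp_mono hα0'.le hα1' m fun b _ => sq _ ?_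
        have : (h 0 : ℝ) ≤ walkMax h b m := by
          rw [← walk_zero h b]; exact_mod_cast walk_le_walkMax h b (Nat.zero_le m)
        exact le_trans (by linarith) (le_abs_self _)
      linarith
    · have a1 : bitExp α m (fun b => ind (walkMax h b m = h 0)) ≤
          bitExp α m ((g ^ 2)⁻¹ • fun b => ((walkMax h b m : ℝ) - μ) ^ 2) := by
        refine bitExp_mono hα0.le hα1 m fun b _ => ?_
        by_cases hA : walkMax h b m = h 0
        · rw [ind_of hA]
          refine sq _ ?_
          rw [hA]
          exact le_trans (by linarith) (neg_le_abs _)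
        · rw [ind_of_not hA]
          exact mul_nonneg hg2.le (sq_nonneg _)
      linarith) t 0 antitone_const
  rw [map_smul, map_add] at h1
  simp only [Pi.add_apply, Pi.smul_apply, smul_eq_mul] at h1
  refine h1.trans ?_
  gcongr
end

section
variable {m s : ℕ} {p r δ : ℝ} (hp : 0 ≤ p) (hmp : m * p ≤ 1) (hr : 0 < r) (hδ : 0 < δ)
  (hδ1 : δ ≤ 1 / 2) (hrδ : r ≤ δ ^ 2 / 8) (hmr : m * r ^ 2 = p * s) (hM : 1280 / δ ^ 6 ≤ m * r)
include hp hmp hr hδ hδ1 hrδ hmr hM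

/-- At bit density slightly above critical the boundary is almost never the maximizer. -/
theorem rowOp_pow_ind_le_sq {t : ℕ} (ht : t ≤ s) :
    (rowOp m p ^ t) (fun h => bitExp ((1 + δ) * r) m fun b => ind (walkMax h b m = h 0)) 0 ≤
      δ ^ 2 / 4 := by
  induction t using Nat.strong_induction_on with
  | _ t ih =>
  set M := m * r with hMdef
  have hM0 : 0 < M := lt_of_lt_of_le (by positivity) hM
  have hr1 : r ≤ 1 := by nlinarith
  set α := (1 + δ) * r with hα
  have hα0 : 0 < α := by positivity
  have hαδ : α ≤ δ ^ 2 / 4 := by nlinarith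
  have hα1 : α ≤ 1 := by nlinarith
  have hps : p * s = M * r := by rw [hMdef, ← hmr]; ring
  have hpt0 : 0 ≤ p * t := by positivity
  have hpt : p * t ≤ M * r := by
    rw [← hps]; gcongr
  have low := le_rowOp_pow_meanMax hp hmp hα0 hα1 t fun u hu => ih u hu (by omega)
  have up := rowOp_pow_meanMax_le hp hmp hr hr1 t
  set y := p * t / r with hy
  have hy0 : 0 ≤ y := by positivity
  have hyM : y ≤ M := by rw [hy, div_le_iff₀ hr]; exact hpt
  have e1 : t * (p * ((1 - α) / α)) = y * ((1 - α) / (1 + δ)) := by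
    rw [hy, hα]; field_simp
  have e2 : t * (p * ((1 - r) / r)) = y * (1 - r) := by
    rw [hy]; field_simp
  have e3 : m * α = M * (1 + δ) := by rw [hMdef, hα]; ring
  rw [e1, e3] at low
  rw [e2, ← hMdef] at up
  have hz : 1 - δ + δ ^ 2 / 3 ≤ (1 - α) / (1 + δ) * (1 - δ ^ 2 / 4) := by
    rw [div_mul_eq_mul_div, le_div_iff₀ (by positivity)]
    nlinarith [mul_pos hδ hδ, mul_pos hδ (mul_pos hδ hδ)]
  have gap : (rowOp m p ^ t) (meanMax r m) 0 + 2 * (M * δ ^ 2 / 8) ≤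
      (rowOp m p ^ t) (meanMax α m) 0 := by
    have h1 : y * (1 - δ + δ ^ 2 / 3) ≤ y * ((1 - α) / (1 + δ)) * (1 - δ ^ 2 / 4) := by
      rw [mul_assoc]; gcongr
    have h2 : y * (δ - δ ^ 2 / 3) ≤ M * (δ - δ ^ 2 / 3) := by
      have : 0 ≤ δ - δ ^ 2 / 3 := by nlinarith
      gcongr
    have h3 : 0 ≤ y * r := by positivity
    have h4 : 0 ≤ M * δ ^ 2 := by positivity
    nlinarith
  refine (rowOp_pow_ind_le hp hmp hα0 hα1 hr hr1 t (by positivity) gap).trans ?_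
  rw [e1, e2, e3, ← hMdef]
  have h5 : M * (1 + δ) + y * ((1 - α) / (1 + δ)) + (M + y * (1 - r)) ≤ 5 * M := by
    have a1 : y * ((1 - α) / (1 + δ)) ≤ M * 1 := by
      have : 0 ≤ (1 - α) / (1 + δ) := div_nonneg (by linarith) (by linarith)
      gcongr
      rw [div_le_one (by positivity)]; linarith
    have a2 : y * (1 - r) ≤ M * 1 := by
      have : 0 ≤ 1 - r := by linarith
      gcongr
      linarith
    nlinarith
  calc _ ≤ ((M * δ ^ 2 / 8) ^ 2)⁻¹ * (5 * M) := by gcongr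
    _ = (1280 / δ ^ 6) * (δ ^ 2 / 4) / M := by field_simp; norm_num
    _ ≤ M * (δ ^ 2 / 4) / M := by gcongr
    _ = δ ^ 2 / 4 := by field_simp

/-- In the block model the expected height is asymptotically at least `2 * √(p m s)`. -/
theorem le_rowOp_pow_eval_zero :
    (2 - 6 * δ) * (m * r) ≤ (rowOp m p ^ s) (fun h => (h 0 : ℝ)) 0 := by
  have low := le_rowOp_pow_meanMax (m := m) (p := p) (α := (1 + δ) * r) (κ := δ ^ 2 / 4) hp hmp
    (by positivity) (by nlinarith) s
    fun u hu => rowOp_pow_ind_le_sq hp hmp hr hδ hδ1 hrδ hmr hM hu.le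
  have up := rowOp_pow_meanMax_le (m := m) (p := p) (α := (1 + 2 * δ) * r) hp hmp
    (by positivity) (by nlinarith) s
  have ext := rowOp_pow_meanMax_mul_le (m := m) (p := p) (θ := (1 + δ) / (1 + 2 * δ))
    (α := (1 + 2 * δ) * r) hp hmp (by positivity)
    (by rw [div_le_one (by positivity)]; linarith) (by positivity) (by nlinarith) s
  have e0 : (1 + δ) / (1 + 2 * δ) * ((1 + 2 * δ) * r) = (1 + δ) * r := by field_simp
  rw [e0] at ext
  set M := m * r with hMdef
  have hM0 : 0 < M := lt_of_lt_of_le (by positivity) hM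
  have hps : p * s = M * r := by rw [hMdef, ← hmr]; ring
  have e1 : s * (p * ((1 - (1 + δ) * r) / ((1 + δ) * r))) =
      M * ((1 - (1 + δ) * r) / (1 + δ)) := by
    rw [show ∀ x : ℝ, s * (p * x) = p * s * x from fun x => by ring, hps]; field_simp
  have e2 : s * (p * ((1 - (1 + 2 * δ) * r) / ((1 + 2 * δ) * r))) =
      M * ((1 - (1 + 2 * δ) * r) / (1 + 2 * δ)) := by
    rw [show ∀ x : ℝ, s * (p * x) = p * s * x from fun x => by ring, hps]; field_simp
  rw [e1] at low
  rw [e2] at up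
  set φ₁ := (rowOp m p ^ s) (meanMax ((1 + δ) * r) m) 0
  set φ₂ := (rowOp m p ^ s) (meanMax ((1 + 2 * δ) * r) m) 0
  set Λ := (rowOp m p ^ s) (fun h => (h 0 : ℝ)) 0
  have h1 : 2 * M ≤ φ₁ := by
    refine le_trans ?_ low
    have hz : 1 - δ ≤ (1 - (1 + δ) * r) / (1 + δ) * (1 - δ ^ 2 / 4) := by
      rw [div_mul_eq_mul_div, le_div_iff₀ (by positivity)]
      nlinarith [mul_pos hδ hδ, mul_pos hδ (mul_pos hδ hδ)]
    have := mul_le_mul_of_nonneg_left hz hM0.le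
    have e3 : m * ((1 + δ) * r) = M * (1 + δ) := by rw [hMdef]; ring
    rw [e3]
    linarith
  have h2 : φ₂ ≤ M * (2 + 4 * δ ^ 2) := by
    refine up.trans ?_
    have e3 : m * ((1 + 2 * δ) * r) = M * (1 + 2 * δ) := by rw [hMdef]; ring
    have hz : (1 - (1 + 2 * δ) * r) / (1 + 2 * δ) ≤ 1 - 2 * δ + 4 * δ ^ 2 := by
      rw [div_le_iff₀ (by positivity)]
      nlinarith [mul_pos hδ hδ, mul_pos hδ (mul_pos hδ hδ), mul_pos hδ hr]
    have := mul_le_mul_of_nonneg_left hz hM0.le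
    rw [e3]
    linarith
  have h3 : (1 + 2 * δ) * φ₁ ≤ δ * Λ + (1 + δ) * φ₂ := by
    have e4 : (1 + 2 * δ) * ((1 - (1 + δ) / (1 + 2 * δ)) * Λ + (1 + δ) / (1 + 2 * δ) * φ₂) =
        δ * Λ + (1 + δ) * φ₂ := by field_simp; ring
    rw [← e4]; gcongr
  have h4 : (1 + 2 * δ) * (2 * M) ≤ (1 + 2 * δ) * φ₁ := by gcongr
  have h5 : (1 + δ) * φ₂ ≤ (1 + δ) * (M * (2 + 4 * δ ^ 2)) := by gcongr
  have h6 : δ * ((2 - 4 * δ - 4 * δ ^ 2) * M) ≤ δ * Λ := by nlinarith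
  have h7 := le_of_mul_le_mul_left h6 hδ
  have h8 : 0 ≤ δ * (1 - 2 * δ) * M := mul_nonneg (mul_nonneg hδ.le (by linarith)) hM0.le
  nlinarith
end

/-- Transition operator of the profile chain for `i` steps from time `n`. -/
noncomputable def transIter (q : ℝ) : ℕ → ℕ → Module.End ℝ ((ℕ → ℕ) → ℝ)
  | _, 0 => 1
  | n, i + 1 => trans q n * transIter q (n + 1) i

theorem transIter_zero (q : ℝ) (n : ℕ) (F : (ℕ → ℕ) → ℝ) : transIter q n 0 F = F := rfl

theorem transIter_succ (q : ℝ) (n i : ℕ) (F : (ℕ → ℕ) → ℝ) :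
    transIter q n (i + 1) F = trans q n (transIter q (n + 1) i F) := rfl

theorem chainExp_add (q : ℝ) (n i : ℕ) (F : (ℕ → ℕ) → ℝ) :
    chainExp q (n + i) F = chainExp q n (transIter q n i F) := by
  induction i generalizing n with
  | zero => rfl
  | succ i ih => rw [transIter_succ, ← chainExp_succ, ← ih, Nat.add_right_comm, add_assoc]

theorem equivariant_eval_zero : Equivariant fun h => (h 0 : ℝ) where
  mono := fun a b hab => Nat.cast_le.2 (hab 0)
  add_one := fun h => by simp

/-- Bernoulli bound for the shift error. -/
theorem sub_le_pow_div {η : ℝ} (hη0 : 0 < η) (hη1 : η < 1) (m a : ℕ) :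
    (m : ℝ) - a ≤ (1 - η) ^ a / ((1 - η) ^ m * η) := by
  have hz : 0 < 1 - η := by linarith
  rcases le_total m a with h | h
  · have : (m : ℝ) ≤ a := by exact_mod_cast h
    have h2 : 0 ≤ (1 - η) ^ a / ((1 - η) ^ m * η) := by positivity
    linarith
  · obtain ⟨k, rfl⟩ := Nat.exists_eq_add_of_le h
    have h1 : (k : ℝ) * η * (1 - η) ^ k ≤ 1 := by
      have h2 := one_add_mul_le_pow (a := η) (by linarith) k
      have h3 : (1 + η) ^ k * (1 - η) ^ k ≤ 1 := by
        rw [← mul_pow]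
        exact pow_le_one₀ (by nlinarith) (by nlinarith)
      have h4 : 0 < (1 - η) ^ k := by positivity
      nlinarith
    rw [le_div_iff₀ (by positivity), pow_add]
    push_cast
    have h5 : 0 < (1 - η) ^ a := by positivity
    nlinarith

theorem pow_half_le {η : ℝ} (hη0 : 0 < η) (hη1 : η < 1) {m s : ℕ}
    (hms : (m : ℝ) ≤ s * (1 - η) / 2) : (1 - η / 2) ^ s ≤ (1 - η) ^ m := by
  have hz : 0 < 1 - η := by linarith
  have h1 : 1 - η / 2 ≤ Real.exp (-(η / 2)) := by
    linarith [Real.add_one_le_exp (-(η / 2))]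
  have h2 : Real.exp (-(η / (1 - η))) ≤ 1 - η := by
    rw [Real.exp_neg, inv_le_comm₀ (Real.exp_pos _) hz]
    refine le_trans (le_of_eq ?_) (Real.add_one_le_exp (η / (1 - η)))
    field_simp
    ring
  calc (1 - η / 2) ^ s ≤ Real.exp (-(η / 2)) ^ s := by gcongr; linarith
    _ = Real.exp (-(s * (η / 2))) := by rw [← Real.exp_nat_mul]; ring_nf
    _ ≤ Real.exp (-(m * (η / (1 - η)))) := by
      apply Real.exp_le_exp.2
      rw [neg_le_neg_iff, mul_div_assoc', div_le_iff₀ hz]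
      nlinarith
    _ = Real.exp (-(η / (1 - η))) ^ m := by rw [← Real.exp_nat_mul]; ring_nf
    _ ≤ (1 - η) ^ m := by gcongr

section
variable {q η p : ℝ} (hq0 : 0 < q) (hq1 : q < 1) (hη0 : 0 < η) (hη1 : η < 1) {J m s : ℕ}
  (hJ : q ^ J ≤ 1 / 2) (hp : p = (1 - q) * q ^ (J + s + m)) (hmp : m * p ≤ 1)
include hq0 hq1 hη0 hη1 hJ hp hmp

/-- Comparison of the profile chain with the block model on a moving window. -/
theorem le_transIter (i : ℕ) {n a : ℕ} (hn : J + s + m ≤ n) (hai : a + i ≤ s) {h H : ℕ → ℕ}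
    (hh : IsProfile h) (hH : ∀ j ≤ m, H j ≤ h (J + a + j)) :
    (rowOp m p ^ i) (fun h => (h 0 : ℝ)) H -
        (1 - η) ^ a / ((1 - η) ^ m * η) * (1 - η / 2) ^ i ≤
      transIter q n i (fun h => (h (J + m) : ℝ)) h := by
  have hz : 0 < 1 - η := by linarith
  have hp0 : 0 ≤ p := by rw [hp]; exact mul_nonneg (by linarith) (by positivity)
  induction i generalizing n a h H with
  | zero =>
    have h1 := sub_le_pow_div hη0 hη1 m a
    have h3 : (H 0 : ℝ) ≤ h (J + a) := by exact_mod_cast hH 0 (Nat.zero_le m)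
    have h4 : (h (J + a) : ℝ) ≤ h (J + m) + (1 - η) ^ a / ((1 - η) ^ m * η) := by
      rcases le_total a m with ham | ham
      · have h5 : ∀ k, h (J + a) ≤ h (J + a + k) + k := by
          intro k
          induction k with
          | zero => simp
          | succ k ih => have := hh.2 (J + a + k); rw [← add_assoc (J + a)]; omega
        have h6 := h5 (m - a)
        rw [show J + a + (m - a) = J + m by omega] at h6
        have h7 : (h (J + a) : ℝ) + a ≤ h (J + m) + m := by
          exact_mod_cast (show h (J + a) + a ≤ h (J + m) + m by omega)
        linarith
      · have h5 : (h (J + a) : ℝ) ≤ h (J + m) := by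
          exact_mod_cast hh.1 (show J + m ≤ J + a by omega)
        have : 0 ≤ (1 - η) ^ a / ((1 - η) ^ m * η) := by positivity
        linarith
    rw [transIter_zero, pow_zero, pow_zero, mul_one, Module.End.one_apply]
    linarith
  | succ i ih =>
    set F : (ℕ → ℕ) → ℝ := (rowOp m p ^ i) (fun h => (h 0 : ℝ)) with hF
    have hFmono : Monotone F := (equivariant_eval_zero.rowOp_pow hp0 hmp i).mono
    set D := (1 - η) ^ a / ((1 - η) ^ m * η) * (1 - η / 2) ^ i with hD
    have hD0 : 0 ≤ D := by
      have : 0 < 1 - η / 2 := by linarith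
      positivity
    have hD1 : (1 - η) ^ (a + 1) / ((1 - η) ^ m * η) * (1 - η / 2) ^ i = (1 - η) * D := by
      rw [hD]; ring
    have hbump : ∀ k, 0 ≤ F (bump k H) - F H := fun k => sub_nonneg.2 (hFmono (le_bump k H))
    have key : ∀ g, F H - D + η * D * (if g < J then 1 else 0) +
        ∑ k ∈ range m, (if g = J + a + k + 1 then F (bump k H) - F H else 0) ≤
        transIter q (n + 1) i (fun h => (h (J + m) : ℝ)) (depthStep g h) := by
      intro g
      have hstep := le_depthStep hh g
      by_cases hg : g < J
      · have h1 := ih (n := n + 1) (a := a + 1) (by omega) (by omega) (hh.depthStep g) (H := H)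
          (fun j hj => by
            rw [depthStep, if_neg (by omega), show J + (a + 1) + j - 1 = J + a + j by omega]
            exact hH j hj)
        rw [hD1] at h1
        rw [if_pos hg, sum_eq_zero fun k _ => if_neg (by omega)]
        linarith
      · rw [if_neg hg]
        by_cases hk : ∃ k < m, g = J + a + k + 1
        · obtain ⟨k, hkm, hgk⟩ := hk
          have h1 := ih (n := n + 1) (a := a) (by omega) (by omega) (hh.depthStep g)
            (H := bump k H) (fun j hj => by
              have b1 := hH j hj
              have b2 := hH (k + 1) (by omega)
              have b3 := hstep (J + a + j)
              unfold bump
              split_ifs with hjk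
              · rw [depthStep, if_pos (by omega), hgk]
                exact max_le_max b1 (Nat.add_le_add_right b2 1)
              · exact b1.trans b3)
          rw [sum_eq_single_of_mem k (mem_range.2 hkm) fun l _ hl => if_neg (by omega),
            if_pos hgk]
          linarith
        · have h1 := ih (n := n + 1) (a := a) (by omega) (by omega) (hh.depthStep g) (H := H)
            (fun j hj => (hH j hj).trans (hstep _))
          rw [sum_eq_zero fun k hk' => if_neg fun e => hk ⟨k, mem_range.1 hk', e⟩]
          linarith
    have hW := fun g => depthWeight_nonneg hq0 hq1 n g
    have hsum : ∑ g ∈ range (n + 1), depthWeight q n g *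
        (F H - D + η * D * (if g < J then 1 else 0) +
          ∑ k ∈ range m, (if g = J + a + k + 1 then F (bump k H) - F H else 0)) =
        F H - D + η * D * ∑ g ∈ range J, depthWeight q n g +
          ∑ k ∈ range m, depthWeight q n (J + a + k + 1) * (F (bump k H) - F H) := by
      simp only [mul_add, sum_add_distrib]
      rw [← sum_mul, sum_depthWeight hq0 hq1, one_mul]
      congr 1
      · congr 1
        rw [mul_sum]
        rw [← sum_subset (range_mono (show J ≤ n + 1 by omega))]
        · refine sum_congr rfl fun g hg => ?_
          rw [if_pos (mem_range.1 hg)]; ring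
        · intro g _ hg
          rw [if_neg (by simpa using hg)]; ring
      · simp only [mul_sum]
        rw [sum_comm]
        refine sum_congr rfl fun k hk => ?_
        rw [mem_range] at hk
        rw [sum_eq_single_of_mem (J + a + k + 1) (mem_range.2 (by omega))
          fun g _ hg => by rw [if_neg hg, mul_zero], if_pos rfl]
    have h1 : 1 / 2 ≤ ∑ g ∈ range J, depthWeight q n g := by
      rw [sum_depthWeight_range, le_div_iff₀ (one_sub_pow_pos hq0 hq1 n)]
      have : 0 < q ^ (n + 1) := by positivity
      linarith
    have h2 : p * ∑ k ∈ range m, (F (bump k H) - F H) ≤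
        ∑ k ∈ range m, depthWeight q n (J + a + k + 1) * (F (bump k H) - F H) := by
      rw [mul_sum]
      refine sum_le_sum fun k hk => mul_le_mul_of_nonneg_right ?_ (hbump k)
      rw [mem_range] at hk
      rw [hp, depthWeight, le_div_iff₀ (one_sub_pow_pos hq0 hq1 n)]
      have a1 : q ^ (J + s + m) ≤ q ^ (J + a + k + 1) :=
        pow_le_pow_of_le_one hq0.le hq1.le (by omega)
      have a2 : 0 < q ^ (J + s + m) := by positivity
      have a3 : 0 < q ^ (n + 1) := by positivity
      calc (1 - q) * q ^ (J + s + m) * (1 - q ^ (n + 1)) ≤ (1 - q) * q ^ (J + s + m) * 1 := by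
            have : 0 ≤ (1 - q) * q ^ (J + s + m) := mul_nonneg (by linarith) a2.le
            gcongr
            linarith
        _ ≤ _ := by
          rw [mul_one]
          have : 0 ≤ 1 - q := by linarith
          gcongr
    have h3 : η * D * (1 / 2) ≤ η * D * ∑ g ∈ range J, depthWeight q n g := by gcongr
    rw [transIter_succ, trans_apply, rowOp_pow_succ', rowOp_apply, ← hF]
    refine le_trans ?_ (sum_le_sum fun g _ => mul_le_mul_of_nonneg_left (key g) (hW g))
    rw [hsum]
    have h4 : (1 - η) ^ a / ((1 - η) ^ m * η) * (1 - η / 2) ^ (i + 1) = D * (1 - η / 2) := by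
      rw [hD]; ring
    rw [h4]
    rw [sum_sub_distrib, sum_const, card_range, nsmul_eq_mul] at h2
    linarith

variable (hms : (m : ℝ) ≤ s * (1 - η) / 2)
include hms

theorem le_chainExp_add {n : ℕ} (hn : J + s + m ≤ n) :
    chainExp q n (fun h => (h (J + m) : ℝ)) +
        ((rowOp m p ^ s) (fun h => (h 0 : ℝ)) 0 - 1 / η) ≤
      chainExp q (n + s) (fun h => (h (J + m) : ℝ)) := by
  have hz : 0 < 1 - η := by linarith
  have hp0 : 0 ≤ p := by rw [hp]; exact mul_nonneg (by linarith) (by positivity)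
  rw [← chainExp_add_const hq0 hq1, chainExp_add]
  refine chainExp_mono hq0 hq1 n fun h hh => ?_
  have h1 := le_transIter hq0 hq1 hη0 hη1 hJ hp hmp s hn (a := 0) (by omega) hh
    (H := 0 + fun _ => h (J + m)) (fun j hj => by
      simp only [Pi.add_apply, Pi.zero_apply, zero_add]
      exact hh.1 (by omega))
  rw [(equivariant_eval_zero.rowOp_pow hp0 hmp s).add_const] at h1
  have h2 := pow_half_le hη0 hη1 hms
  have h3 : (1 - η) ^ 0 / ((1 - η) ^ m * η) * (1 - η / 2) ^ s ≤ 1 / η := by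
    have : 0 < (1 - η) ^ m := by positivity
    rw [pow_zero, div_mul_eq_mul_div, one_mul, div_le_div_iff₀ (by positivity) hη0]
    nlinarith
  linarith

theorem mul_le_chainExp (K : ℕ) :
    K * ((rowOp m p ^ s) (fun h => (h 0 : ℝ)) 0 - 1 / η) ≤
      chainExp q (J + s + m + K * s) (fun h => (h (J + m) : ℝ)) := by
  induction K with
  | zero =>
    rw [Nat.cast_zero, zero_mul, ← chainExp_const hq0 hq1 (J + s + m + 0 * s) 0]
    exact chainExp_mono hq0 hq1 _ fun h _ => Nat.cast_nonneg _
  | succ K ih =>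
    have := le_chainExp_add hq0 hq1 hη0 hη1 hJ hp hmp hms (n := J + s + m + K * s) (by omega)
    rw [show J + s + m + (K + 1) * s = J + s + m + K * s + s by ring]
    push_cast
    linarith
end

theorem chainExp_eval_zero_mono {q : ℝ} (hq0 : 0 < q) (hq1 : q < 1) :
    Monotone fun n => chainExp q n (fun h => (h 0 : ℝ)) := by
  refine monotone_nat_of_le_succ fun n => ?_
  rw [chainExp_succ]
  refine chainExp_mono hq0 hq1 n fun h hh => ?_
  have h1 : trans q n (fun _ => (h 0 : ℝ)) h ≤ trans q n (fun h => (h 0 : ℝ)) h := by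
    rw [trans_apply, trans_apply]
    refine sum_le_sum fun g _ => mul_le_mul_of_nonneg_left ?_ (depthWeight_nonneg hq0 hq1 n g)
    exact_mod_cast le_depthStep hh g 0
  rwa [trans_const hq0 hq1] at h1

theorem exists_pow_le_half {q : ℝ} (hq0 : 3 / 4 ≤ q) (hq1 : q < 1) :
    ∃ J : ℕ, q ^ J ≤ 1 / 2 ∧ q / 2 ≤ q ^ J ∧ (J : ℝ) * (1 - q) ≤ 3 := by
  have hq : 0 < q := by linarith
  classical
  have hex : ∃ J : ℕ, q ^ J ≤ 1 / 2 := by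
    obtain ⟨J, hJ⟩ := exists_pow_lt_of_lt_one (show (0 : ℝ) < 1 / 2 by norm_num) hq1
    exact ⟨J, hJ.le⟩
  have h1 := Nat.find_spec hex
  have h0 : Nat.find hex ≠ 0 := by
    intro e
    rw [e] at h1
    norm_num at h1
  obtain ⟨j, hj⟩ := Nat.exists_eq_succ_of_ne_zero h0
  have h2 := Nat.find_min hex (show j < Nat.find hex by omega)
  rw [hj] at h1
  push Not at h2
  have h3 : q / 2 ≤ q ^ (j + 1) := by rw [pow_succ]; nlinarith
  refine ⟨j + 1, h1, h3, ?_⟩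
  have h4 := one_sub_mul_pow_le hq hq1 j
  have h5 : 0 ≤ ((j : ℝ) + 1) * (1 - q) := mul_nonneg (by positivity) (by linarith)
  push_cast
  nlinarith

theorem scale_bounds {a δ C : ℝ} (ha : 0 < a) (hδ : 0 < δ) (hδ1 : δ ≤ 1 / 8)
    (hC : 4000 / δ ^ 6 ≤ C) (haC : a * (4 * (C + 1)) ≤ δ) :
    64 ≤ C ∧ 1 / δ ^ 2 ≤ C ∧ 2 ≤ C * δ ∧ a ≤ δ ^ 2 / 16 := by
  have hC0 : 0 < C := lt_of_lt_of_le (by positivity) hC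
  have hδ2 : δ ^ 2 ≤ 1 / 64 := by
    have : δ ^ 2 ≤ (1 / 8) ^ 2 := by gcongr
    linarith
  have hδ4 : δ ^ 4 ≤ 1 / 4096 := by
    have : δ ^ 4 ≤ (1 / 8) ^ 4 := by gcongr
    linarith
  have hCδ : 4000 ≤ C * δ ^ 6 := by rwa [div_le_iff₀ (by positivity)] at hC
  have h1 : 64 ≤ C * δ ^ 2 := by
    have : C * δ ^ 2 * δ ^ 4 ≤ C * δ ^ 2 * (1 / 4096) := by gcongr
    have h : C * δ ^ 2 * δ ^ 4 = C * δ ^ 6 := by ring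
    linarith
  have h2 : C * δ ^ 2 ≤ C * (1 / 64) := by gcongr
  have h3 : C * δ * δ ≤ C * δ * (1 / 8) := by gcongr
  have h4 : C * δ * δ = C * δ ^ 2 := by ring
  refine ⟨by linarith, ?_, by linarith, ?_⟩
  · rw [div_le_iff₀ (by positivity)]
    linarith
  · have h5 : a * 64 ≤ a * (C * δ ^ 2) := by gcongr
    have h6 : δ ^ 2 * (a * (4 * C)) ≤ δ ^ 2 * δ := by
      gcongr
      linarith
    have h7 : δ ^ 2 * δ ≤ δ ^ 2 * (1 / 8) := by gcongr
    have h8 : δ ^ 2 * (a * (4 * C)) = 4 * (a * (C * δ ^ 2)) := by ring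
    have h9 : 0 < δ ^ 2 := by positivity
    linarith

theorem exists_block_size {a δ C : ℝ} (ha : 0 < a) (hδ : 0 < δ) (hδ1 : δ ≤ 1 / 8)
    (ha1 : a ≤ 1) (hCδ : 2 ≤ C * δ) (hC : 0 < C) :
    ∃ s m : ℕ, C ≤ a * s ∧ a * s ≤ C + a ∧ 0 < (s : ℝ) ∧ (s : ℝ) / 4 ≤ m ∧
      (m : ℝ) ≤ s * (1 - δ) / 2 ∧ (s : ℝ) * (1 - 2 * δ) / 2 ≤ m := by
  have hs1 : C ≤ a * ⌈C / a⌉₊ := by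
    have := Nat.le_ceil (C / a)
    rw [div_le_iff₀ ha] at this
    linarith
  have hs2 : a * ⌈C / a⌉₊ ≤ C + a := by
    have := (Nat.ceil_lt_add_one (show 0 ≤ C / a by positivity)).le
    calc a * ⌈C / a⌉₊ ≤ a * (C / a + 1) := by gcongr
      _ = C + a := by field_simp
  set s := ⌈C / a⌉₊
  have hs3 : C ≤ s := by
    have : a * s ≤ 1 * s := by gcongr
    linarith
  have hs0 : (0 : ℝ) < s := by linarith
  have hm0 : 0 ≤ (s : ℝ) * (1 - δ) / 2 := by
    have : 0 ≤ 1 - δ := by linarith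
    positivity
  have hms' : (s : ℝ) * (1 - 2 * δ) / 2 ≤ ⌊(s : ℝ) * (1 - δ) / 2⌋₊ := by
    have h1 := (Nat.lt_floor_add_one ((s : ℝ) * (1 - δ) / 2)).le
    have h2 : C * δ ≤ s * δ := by gcongr
    linarith
  refine ⟨s, _, hs1, hs2, hs0, ?_, Nat.floor_le hm0, hms'⟩
  have : (s : ℝ) * δ ≤ s * (1 / 8) := by gcongr
  linarith

theorem success_prob_bounds {q a δ : ℝ} {J s m : ℕ} (hq0 : 1 - δ / 2 ≤ q) (hq1 : q < 1)
    (ha : 0 < a) (haq : a ^ 2 = 1 - q) (hδ1 : δ ≤ 1 / 8) (hJ : q ^ J ≤ 1 / 2)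
    (hJ' : q / 2 ≤ q ^ J) (hsa : a ^ 2 * s ≤ δ / 4) (hms : m ≤ s) :
    a ^ 2 / 2 * (1 - δ) ≤ (1 - q) * q ^ (J + s + m) ∧
      (1 - q) * q ^ (J + s + m) ≤ a ^ 2 / 2 := by
  have hq : 0 < q := by linarith
  have ha2 : 0 < a ^ 2 := by positivity
  have hpq : (1 - q) * q ^ (J + s + m) = a ^ 2 * (q ^ J * q ^ (s + m)) := by
    rw [haq, add_assoc, pow_add]
  have hpow : 1 - δ / 2 ≤ q ^ (s + m) := by
    have h1 := one_add_mul_le_pow (a := q - 1) (by linarith) (s + m)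
    rw [add_sub_cancel, show q - 1 = -a ^ 2 by linarith] at h1
    have h2 : a ^ 2 * (s + m : ℕ) ≤ a ^ 2 * (s + s : ℕ) := by gcongr
    push_cast at h1 h2
    linarith
  rw [hpq]
  constructor
  · have h1 : (1 - δ / 2) / 2 ≤ q ^ J := by linarith
    have h2 : (1 - δ / 2) / 2 * (1 - δ / 2) ≤ q ^ J * q ^ (s + m) := by
      have : 0 ≤ 1 - δ / 2 := by linarith
      gcongr
    have h3 : (1 - δ) / 2 ≤ (1 - δ / 2) / 2 * (1 - δ / 2) := by nlinarith [sq_nonneg δ]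
    calc a ^ 2 / 2 * (1 - δ) = a ^ 2 * ((1 - δ) / 2) := by ring
      _ ≤ _ := by
        gcongr
        linarith
  · have h1 : q ^ (s + m) ≤ 1 := pow_le_one₀ hq.le hq1.le
    have h2 : q ^ J * q ^ (s + m) ≤ 1 / 2 * 1 := by gcongr
    calc a ^ 2 * (q ^ J * q ^ (s + m)) ≤ a ^ 2 * (1 / 2 * 1) := by gcongr
      _ = _ := by ring

theorem block_gain {a δ C p r : ℝ} {s m : ℕ} (ha : 0 < a) (hδ : 0 < δ) (hδ1 : δ ≤ 1 / 8)
    (hs1 : C ≤ a * s) (hs0 : 0 < (s : ℝ)) (hsm : (s : ℝ) / 4 ≤ m)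
    (hms' : (s : ℝ) * (1 - 2 * δ) / 2 ≤ m) (hp0 : 0 < p) (hp1 : a ^ 2 / 2 * (1 - δ) ≤ p)
    (hp2 : p ≤ a ^ 2 / 2) (hr : r = √(p * s / m)) :
    0 < r ∧ m * r ^ 2 = p * s ∧ r ≤ 2 * a ∧ a * s / 2 * (1 - 2 * δ) ≤ m * r ∧
      3 / 8 * C ≤ m * r := by
  have hm1 : (0 : ℝ) < m := by linarith
  have hr0 : 0 < r := hr ▸ Real.sqrt_pos.2 (by positivity)
  have hr2 : r ^ 2 = p * s / m := by rw [hr, Real.sq_sqrt (by positivity)]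
  have hmr : m * r ^ 2 = p * s := by rw [hr2]; field_simp
  have hM : a * s / 2 * (1 - 2 * δ) ≤ m * r := by
    refine le_of_sq_le_sq ?_ (by positivity)
    have h1 : (m * r) ^ 2 = p * (s * m) := by
      rw [mul_pow, sq (m : ℝ), mul_assoc, hmr]; ring
    rw [h1]
    calc (a * s / 2 * (1 - 2 * δ)) ^ 2 =
          a ^ 2 / 2 * (1 - 2 * δ) * (s * (s * (1 - 2 * δ) / 2)) := by ring
      _ ≤ a ^ 2 / 2 * (1 - δ) * (s * m) := by
        have h2 : 0 ≤ 1 - 2 * δ := by linarith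
        have h3 : 0 ≤ 1 - δ := by linarith
        gcongr
        linarith
      _ ≤ p * (s * m) := by gcongr
  refine ⟨hr0, hmr, ?_, hM, ?_⟩
  · rw [hr, Real.sqrt_le_left (by positivity), div_le_iff₀ hm1]
    have h2 : p * s ≤ a ^ 2 / 2 * s := by gcongr
    have h4 : a ^ 2 * (s / 4) ≤ a ^ 2 * m := by gcongr
    have h5 : 0 < a ^ 2 * s := by positivity
    linarith
  · refine le_trans ?_ hM
    have h1 : a * s * δ ≤ a * s * (1 / 8) := by gcongr
    linarith

theorem exists_mul_le_of_le {N b s : ℕ} (hs : 0 < s) (hN : b ≤ N) :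
    ∃ K : ℕ, b + K * s ≤ N ∧ N ≤ K * s + (b + s) := by
  have hdiv := Nat.div_add_mod (N - b) s
  have hmod := Nat.mod_lt (N - b) hs
  rw [mul_comm] at hdiv
  exact ⟨(N - b) / s, by omega, by omega⟩

theorem le_chainExp_eval_zero {q a δ C : ℝ} (hq1 : q < 1) (ha : 0 < a)
    (haq : a ^ 2 = 1 - q) (hδ : 0 < δ) (hδ1 : δ ≤ 1 / 8) (hC : 4000 / δ ^ 6 ≤ C)
    (haC : a * (4 * (C + 1)) ≤ δ) (N : ℕ) :
    (1 - 6 * δ) * a * (N - 8 / a ^ 2) ≤ chainExp q N (fun h => (h 0 : ℝ)) := by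
  obtain ⟨hC1, hC2, hCδ, haδ⟩ := scale_bounds ha hδ hδ1 hC haC
  have hδ2 : δ ^ 2 ≤ 1 / 8 * δ := by
    rw [sq]
    gcongr
  have ha1 : a ≤ 1 / 64 := by linarith
  have ha2 : a ^ 2 ≤ 1 / 64 * a := by
    rw [sq]
    gcongr
  have hq0 : 1 - δ / 2 ≤ q := by linarith
  have hq : 0 < q := by linarith
  obtain ⟨J, hJ, hJ', hJ1⟩ := exists_pow_le_half (by linarith) hq1
  obtain ⟨s, m, hs1, hs2, hs0, hsm, hms, hms'⟩ :=
    exists_block_size (C := C) ha hδ hδ1 (by linarith) hCδ (by linarith)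
  have hsa : a ^ 2 * s ≤ δ / 4 := by
    have : a * (a * s) ≤ a * (C + 1) := by
      gcongr
      linarith
    rw [sq, mul_assoc]
    linarith
  have hm1 : (0 : ℝ) < m := by linarith
  have hmles : (m : ℝ) ≤ s := by
    have := mul_pos hs0 hδ
    linarith
  obtain ⟨hp1, hp2⟩ := success_prob_bounds hq0 hq1 ha haq hδ1 hJ hJ' hsa
    (by exact_mod_cast hmles : m ≤ s)
  have hp0 : 0 < (1 - q) * q ^ (J + s + m) := by
    rw [← haq]
    positivity
  obtain ⟨p, hp⟩ : ∃ p, p = (1 - q) * q ^ (J + s + m) := ⟨_, rfl⟩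
  rw [← hp] at hp0 hp1 hp2
  have hmp : m * p ≤ 1 := by
    have h1 : m * p ≤ s * (a ^ 2 / 2) := by gcongr
    linarith
  obtain ⟨r, hr⟩ : ∃ r, r = √(p * s / m) := ⟨_, rfl⟩
  obtain ⟨hr0, hmr, hra, hM, hMC⟩ := block_gain ha hδ hδ1 hs1 hs0 hsm hms' hp0 hp1 hp2 hr
  have hrδ : r ≤ δ ^ 2 / 8 := by linarith
  have hM' : 1280 / δ ^ 6 ≤ m * r := by
    have h2 : 1280 / δ ^ 6 = 1280 / 4000 * (4000 / δ ^ 6) := by ring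
    rw [h2]
    linarith
  have hΛ := le_rowOp_pow_eval_zero (s := s) hp0.le hmp hr0 hδ (by linarith) hrδ hmr hM'
  have hch := mul_le_chainExp hq hq1 hδ (by linarith) hJ hp hmp hms
  generalize (rowOp m p ^ s) (fun h => (h 0 : ℝ)) 0 = Λ at hΛ hch
  have hstep : (1 - 6 * δ) * (a * s) ≤ Λ - 1 / δ := by
    have h1 : (2 - 6 * δ) * (a * s / 2 * (1 - 2 * δ)) ≤ (2 - 6 * δ) * (m * r) := by
      have : 0 ≤ 2 - 6 * δ := by linarith
      gcongr
    have h2 : 1 / δ ≤ δ * (a * s) := by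
      rw [div_le_iff₀ hδ]
      rw [div_le_iff₀ (by positivity)] at hC2
      nlinarith
    have h3 : 0 ≤ δ ^ 2 * (a * s) := by positivity
    nlinarith
  have hn0 : ((J + s + m + s : ℕ) : ℝ) ≤ 8 / a ^ 2 := by
    rw [le_div_iff₀ (by positivity)]
    push_cast
    have h1 : a ^ 2 * m ≤ a ^ 2 * s := by gcongr
    rw [← haq] at hJ1
    linarith
  rcases Nat.lt_or_ge N (J + s + m) with hN | hN
  · refine le_trans (b := 0) ?_ ?_
    · have h1 : (N : ℝ) ≤ ((J + s + m + s : ℕ) : ℝ) := by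
        exact_mod_cast (show N ≤ J + s + m + s by omega)
      exact mul_nonpos_of_nonneg_of_nonpos (mul_nonneg (by linarith) ha.le) (by linarith)
    · rw [← chainExp_const hq hq1 N 0]
      exact chainExp_mono hq hq1 _ fun h _ => Nat.cast_nonneg _
  · obtain ⟨K, hK, hKs⟩ := exists_mul_le_of_le (by exact_mod_cast hs0) hN
    have h1 : (N : ℝ) - 8 / a ^ 2 ≤ K * s := by
      have : (N : ℝ) ≤ K * s + ((J + s + m + s : ℕ) : ℝ) := by exact_mod_cast hKs
      linarith only [this, hn0]
    have h2 : 0 ≤ (1 - 6 * δ) * a := mul_nonneg (by linarith only [hδ1]) ha.le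
    calc (1 - 6 * δ) * a * (N - 8 / a ^ 2) ≤ (1 - 6 * δ) * a * (K * s) :=
          mul_le_mul_of_nonneg_left h1 h2
      _ = K * ((1 - 6 * δ) * (a * s)) := by ring
      _ ≤ K * (Λ - 1 / δ) := mul_le_mul_of_nonneg_left hstep (Nat.cast_nonneg K)
      _ ≤ _ := hch K
      _ ≤ chainExp q (J + s + m + K * s) (fun h => (h 0 : ℝ)) :=
        chainExp_mono hq hq1 _ fun h hh => by exact_mod_cast hh.1 (Nat.zero_le _)
      _ ≤ _ := chainExp_eval_zero_mono hq hq1 hK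

open Filter Topology in
theorem tendsto_mean (q : ℕ → ℝ) (hq0 : ∀ n, 0 < q n) (hq1 : ∀ n, q n < 1)
    (hq : Tendsto q atTop (𝓝 1)) (hnq : Tendsto (fun n : ℕ => (n : ℝ) * (1 - q n)) atTop atTop) :
    Tendsto (fun n => chainExp (q n) n (fun h => (h 0 : ℝ)) / ((n : ℝ) * √(1 - q n)))
      atTop (𝓝 1) := by
  set a : ℕ → ℝ := fun n => √(1 - q n) with ha
  have ha0 : ∀ n, 0 < a n := fun n => Real.sqrt_pos.2 (by linarith [hq1 n])
  have haq : ∀ n, a n ^ 2 = 1 - q n := fun n => Real.sq_sqrt (by linarith [hq1 n])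
  have hat : Tendsto a atTop (𝓝 0) := by
    have : Tendsto (fun n => √(1 - q n)) atTop (𝓝 √(1 - 1)) := (tendsto_const_nhds.sub hq).sqrt
    simpa using this
  have hinv : Tendsto (fun n : ℕ => ((n : ℝ) * (1 - q n))⁻¹) atTop (𝓝 0) :=
    tendsto_inv_atTop_zero.comp hnq
  have hinv2 : Tendsto (fun n : ℕ => (√((n : ℝ) * (1 - q n)))⁻¹) atTop (𝓝 0) :=
    tendsto_inv_atTop_zero.comp (Real.tendsto_sqrt_atTop.comp hnq)
  rw [tendsto_order]
  constructor
  · intro b hb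
    obtain ⟨δ, hδ0, hδ1, hδb⟩ : ∃ δ : ℝ, 0 < δ ∧ δ ≤ 1 / 8 ∧ b < 1 - 6 * δ :=
      ⟨min (1 / 8) ((1 - b) / 12), lt_min (by norm_num) (by linarith), min_le_left _ _, by
        linarith [min_le_right (1 / 8 : ℝ) ((1 - b) / 12)]⟩
    have hlim : Tendsto (fun n : ℕ => (1 - 6 * δ) * (1 - 8 * ((n : ℝ) * (1 - q n))⁻¹)) atTop
        (𝓝 ((1 - 6 * δ) * (1 - 8 * 0))) :=
      (tendsto_const_nhds.sub (hinv.const_mul 8)).const_mul _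
    have hsmall : ∀ᶠ n in atTop, a n * (4 * (4000 / δ ^ 6 + 1)) < δ := by
      have := hat.mul_const (4 * (4000 / δ ^ 6 + 1))
      rw [zero_mul] at this
      exact this.eventually_lt_const hδ0
    filter_upwards [hlim.eventually_const_lt (by simpa using hδb), hsmall, eventually_gt_atTop 0]
      with n h1 h2 hn
    have hn' : (0 : ℝ) < n := by exact_mod_cast hn
    refine h1.trans_le ?_
    have h3 := ha0 n
    have h4 := le_chainExp_eval_zero (hq1 n) h3 (haq n) hδ0 hδ1 le_rfl h2.le n
    rw [le_div_iff₀ (by positivity)]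
    refine le_trans (le_of_eq ?_) h4
    change (1 - 6 * δ) * (1 - 8 * ((n : ℝ) * (1 - q n))⁻¹) * (n * a n) = _
    rw [← haq]
    field_simp
  · intro b hb
    obtain ⟨ε, hε0, hε1, hεb⟩ : ∃ ε : ℝ, 0 < ε ∧ ε ≤ 1 / 4 ∧ 1 + ε < b :=
      ⟨min (1 / 4) ((b - 1) / 2), lt_min (by norm_num) (by linarith), min_le_left _ _, by
        linarith [min_le_right (1 / 4 : ℝ) ((b - 1) / 2)]⟩
    have hlim : Tendsto (fun n : ℕ => (1 + ε) + (1 + 2 / ε ^ 2) * a n +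
        12 * (√((n : ℝ) * (1 - q n)))⁻¹ +
        (2 + 1 / (2 * ε)) / ε * ((n : ℝ) * (1 - q n))⁻¹) atTop
        (𝓝 ((1 + ε) + (1 + 2 / ε ^ 2) * 0 + 12 * 0 + (2 + 1 / (2 * ε)) / ε * 0)) :=
      ((tendsto_const_nhds.add (hat.const_mul _)).add (hinv2.const_mul _)).add (hinv.const_mul _)
    filter_upwards [hlim.eventually_lt_const (by simpa using hεb), eventually_gt_atTop 0]
      with n h1 hn
    have hn' : (0 : ℝ) < n := by exact_mod_cast hn
    refine lt_of_le_of_lt ?_ h1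
    have h3 := ha0 n
    have h4 := chainExp_eval_zero_le (hq0 n) (hq1 n) h3 (haq n) hε0 hε1 n
    rw [div_le_iff₀ (by positivity)]
    refine h4.trans (le_of_eq ?_)
    have h5 : √((n : ℝ) * (1 - q n)) = √n * a n := Real.sqrt_mul hn'.le _
    have h6 : (n : ℝ) = √n ^ 2 := (Real.sq_sqrt hn'.le).symm
    have h7 : 0 < √(n : ℝ) := Real.sqrt_pos.2 hn'
    rw [h5]
    change _ = (1 + ε + (1 + 2 / ε ^ 2) * a n + 12 * (√n * a n)⁻¹ +
      (2 + 1 / (2 * ε)) / ε * (n * (1 - q n))⁻¹) * (n * a n)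
    rw [← haq]
    set u := √(n : ℝ)
    rw [h6]
    field_simp

end MallowsLIS

/-- If `q_n → 1` and `n(1−q_n) → ∞`, and `π_n ~ μ_{n,q_n}`, then
`LIS(π_n)/(n√(1−q_n)) → 1` in `L_p` for every `0<p<∞`. -/
theorem mallows_LIS_law_of_large_numbers (q : ℕ → ℝ)
    (hq0 : ∀ n, 0 < q n) (hq1 : ∀ n, q n < 1)
    (hq_to_one : Filter.Tendsto q Filter.atTop (nhds 1))
    (hnq : Filter.Tendsto (fun n : ℕ => (n : ℝ) * (1 - q n)) Filter.atTop Filter.atTop) :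
    ∀ p : ℝ, 0 < p →
      Filter.Tendsto
        (fun n : ℕ => mallowsExp n (q n)
          (fun π => |(LIS π : ℝ) / ((n : ℝ) * Real.sqrt (1 - q n)) - 1| ^ p))
        Filter.atTop (nhds 0) := by
  exact MallowsLIS.tendsto_Lp_of_tendsto_mean q hq0 hq1 hnq
    (MallowsLIS.tendsto_mean q hq0 hq1 hq_to_one hnq)
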